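/- arXiv:2403.11994 — 6 statements merged into one kernel-verified Lean document; each statement's English description precedes it below -/
import Mathlib

section
/- Let n ≥ 1 and let a be a unit vector in ℝ^{n+1} with Σ_j a_j = 0. Then p_a(0) ≤ 1/√2, with equality if and only if a = (e_j − e_k)/√2 for some j ≠ k. -/
open MeasureTheory ProbabilityTheory Real

/-- `p` is the (continuous) probability density of `∑ⱼ aⱼ Xⱼ`, where `X₁, X₂, ...` are
i.i.d. standard exponential random variables (density `e^{-x} 1_{(0,∞)}(x)` on `ℝ`). -/
def IsExpSumDensity {m : ℕ} (a : Fin m → ℝ) (p : ℝ → ℝ) : Prop :=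
  Continuous p ∧
    Measure.map (fun x : Fin m → ℝ => ∑ j, a j * x j) (Measure.pi fun _ => expMeasure 1)
      = volume.withDensity fun x => ENNReal.ofReal (p x)

instance : IsProbabilityMeasure (expMeasure 1) := isProbabilityMeasure_expMeasure one_pos

lemma expMeasure_one_eq :
    expMeasure 1 = (volume.restrict (Set.Ioi (0 : ℝ))).withDensity
      fun x => ENNReal.ofReal (exp (-x)) := by
  have h : expMeasure 1 = volume.withDensity (exponentialPDF 1) := rfl
  rw [h, ← withDensity_indicator measurableSet_Ioi]
  refine withDensity_congr_ae ?_
  filter_upwards [compl_mem_ae_iff.mpr (measure_singleton (0 : ℝ))] with x hx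
  have hx : x ≠ 0 := hx
  rw [exponentialPDF_eq, Set.indicator_apply]
  rcases hx.lt_or_gt with h | h
  · simp [h.not_ge, h.le]
  · simp [h.le, h]

lemma integral_expMeasure {E : Type*} [NormedAddCommGroup E] [NormedSpace ℝ E] (f : ℝ → E) :
    ∫ x, f x ∂expMeasure 1 = ∫ x in Set.Ioi 0, exp (-x) • f x := by
  rw [expMeasure_one_eq, integral_withDensity_eq_integral_toReal_smul (by fun_prop) (by simp)]
  simp [ENNReal.toReal_ofReal (exp_pos _).le]

lemma integrable_expMeasure_iff {E : Type*} [NormedAddCommGroup E] [NormedSpace ℝ E]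
    {f : ℝ → E} :
    Integrable f (expMeasure 1) ↔ IntegrableOn (fun x => exp (-x) • f x) (Set.Ioi 0) := by
  rw [expMeasure_one_eq, integrable_withDensity_iff_integrable_smul' (by fun_prop) (by simp)]
  simp [ENNReal.toReal_ofReal (exp_pos _).le, IntegrableOn]

lemma lintegral_expMeasure {f : ℝ → ENNReal} (hf : Measurable f) :
    ∫⁻ x, f x ∂expMeasure 1 = ∫⁻ x in Set.Ioi 0, ENNReal.ofReal (exp (-x)) * f x := by
  rw [expMeasure_one_eq, lintegral_withDensity_eq_lintegral_mul _ (by fun_prop) hf]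
  rfl

lemma integrable_id_expMeasure : Integrable (fun x : ℝ => x) (expMeasure 1) := by
  rw [integrable_expMeasure_iff]
  simpa using Real.GammaIntegral_convergent (s := 2) (by norm_num) |>.congr_fun
    (g := fun x => exp (-x) * x) (fun x hx => by norm_num) measurableSet_Ioi

lemma integral_id_expMeasure : ∫ x, x ∂expMeasure 1 = 1 := by
  rw [integral_expMeasure]
  have := Real.Gamma_eq_integral (s := 2) (by norm_num)
  norm_num at this
  simpa using this.symm

lemma expMeasure_apply {s : Set ℝ} (hs : MeasurableSet s) :
    expMeasure 1 s = ∫⁻ x in s ∩ Set.Ioi 0, ENNReal.ofReal (exp (-x)) := by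
  rw [expMeasure_one_eq, withDensity_apply _ hs, Measure.restrict_restrict hs]

lemma expMeasure_Ioi (c : ℝ) : expMeasure 1 (Set.Ioi c) = ENNReal.ofReal (exp (-max c 0)) := by
  rw [expMeasure_apply measurableSet_Ioi, Set.Ioi_inter_Ioi,
    ← ofReal_integral_eq_lintegral_ofReal (integrableOn_exp_neg_Ioi _)
      (ae_of_all _ fun x => (exp_pos _).le), integral_exp_neg_Ioi]

/-- Over an interval, the exponential law charges at most the length times the upper tail. -/
lemma expMeasure_Ioc_le (c d : ℝ) :
    expMeasure 1 (Set.Ioc c d) ≤ ENNReal.ofReal (d - c) * expMeasure 1 (Set.Ioi c) := by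
  rw [expMeasure_apply measurableSet_Ioc, expMeasure_Ioi, mul_comm, ← Real.volume_Ioc]
  calc ∫⁻ x in Set.Ioc c d ∩ Set.Ioi 0, ENNReal.ofReal (exp (-x))
      ≤ ∫⁻ x in Set.Ioc c d ∩ Set.Ioi 0, ENNReal.ofReal (exp (-max c 0)) := by
        refine setLIntegral_mono' (measurableSet_Ioc.inter measurableSet_Ioi) fun x hx => ?_
        refine ENNReal.ofReal_le_ofReal (exp_le_exp.2 (neg_le_neg (max_le hx.1.1.le hx.2.le)))
    _ ≤ _ := by
        rw [setLIntegral_const]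
        gcongr
        exact Set.inter_subset_left

/-- The mean excess of the exponential law over any level is at least one. -/
lemma expMeasure_Ioi_le_lintegral (c : ℝ) :
    expMeasure 1 (Set.Ioi c) ≤ ∫⁻ x, ENNReal.ofReal (x - c) ∂expMeasure 1 := by
  rw [expMeasure_Ioi, lintegral_expMeasure (by fun_prop)]
  set b := max c 0 with hb
  have hb0 : 0 ≤ b := le_max_right _ _
  have hderiv : ∀ x ∈ Set.Ici b,
      HasDerivAt (fun x => -((x - b + 1) * exp (-x))) (exp (-x) * (x - b)) x := by
    intro x _
    have h1 := ((((hasDerivAt_id x).sub_const b).add_const 1).mul (hasDerivAt_id x).neg.exp).neg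
    refine h1.congr_deriv ?_
    simp only [Pi.neg_apply, id]
    ring
  have hpos : ∀ x ∈ Set.Ioi b, 0 ≤ exp (-x) * (x - b) := fun x hx =>
    mul_nonneg (exp_pos _).le (sub_nonneg.2 (le_of_lt hx))
  have hlim : Filter.Tendsto (fun x => -((x - b + 1) * exp (-x))) Filter.atTop (nhds 0) := by
    have h1 := Real.tendsto_pow_mul_exp_neg_atTop_nhds_zero 1
    have h0 := Real.tendsto_pow_mul_exp_neg_atTop_nhds_zero 0
    rw [show (0 : ℝ) = -(0 + (1 - b) * 0) by simp]
    refine (h1.add (h0.const_mul (1 - b))).neg.congr fun x => ?_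
    ring
  have hint := integral_Ioi_of_hasDerivAt_of_nonneg' hderiv hpos hlim
  have hi := integrableOn_Ioi_deriv_of_nonneg' hderiv hpos hlim
  calc ENNReal.ofReal (exp (-b)) = ∫⁻ x in Set.Ioi b, ENNReal.ofReal (exp (-x) * (x - b)) := by
        rw [← ofReal_integral_eq_lintegral_ofReal hi
          (by filter_upwards [ae_restrict_mem measurableSet_Ioi] with x hx using hpos x hx), hint]
        simp
    _ ≤ ∫⁻ x in Set.Ioi b, ENNReal.ofReal (exp (-x)) * ENNReal.ofReal (x - c) := by
        refine lintegral_mono fun x => ?_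
        rw [ENNReal.ofReal_mul (exp_pos _).le]
        gcongr
        exact le_max_left _ _
    _ ≤ _ := lintegral_mono_set (Set.Ioi_subset_Ioi hb0)

/-- The characteristic function of the exponential law. -/
lemma integral_cexp_expMeasure (t : ℝ) :
    ∫ x, Complex.exp (t * x * Complex.I) ∂expMeasure 1 = (1 - t * Complex.I)⁻¹ := by
  rw [integral_expMeasure]
  have h : (-1 + t * Complex.I).re < 0 := by simp
  have := integral_exp_mul_complex_Ioi h 0
  rw [show (1 - t * Complex.I)⁻¹ = -Complex.exp ((-1 + t * Complex.I) * (0 : ℝ)) /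
    (-1 + t * Complex.I) by
      rw [← neg_sub, inv_neg]
      simp [div_eq_mul_inv, sub_eq_add_neg, add_comm], ← this]
  refine integral_congr_ae (ae_of_all _ fun x => ?_)
  simp only [Complex.real_smul, Complex.ofReal_exp, ← Complex.exp_add]
  congr 1; push_cast; ring

/-- The four-point form of log-concavity: the increment ratios of `k` are nonincreasing. -/
def IncrementLogConcave (k : ℝ → ℝ) : Prop :=
  ∀ w x d : ℝ, w ≤ x → 0 ≤ d → k (x + d) * k w ≤ k x * k (w + d)

lemma incrementLogConcave_max_zero : IncrementLogConcave fun x => max x 0 := by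
  intro w x d hwx hd
  dsimp only
  rcases le_total w 0 with hw | hw
  · rw [max_eq_right hw, mul_zero]
    positivity
  · rw [max_eq_left hw, max_eq_left (hw.trans hwx), max_eq_left (by linarith),
      max_eq_left (by linarith)]
    nlinarith

lemma IncrementLogConcave.comp_neg {k : ℝ → ℝ} (hk : IncrementLogConcave k) :
    IncrementLogConcave fun x => k (-x) := by
  intro w x d hwx hd
  have := hk (-(x + d)) (-(w + d)) d (by linarith) hd
  simp only [neg_add, neg_add_cancel_right] at this ⊢
  linarith

lemma lipschitzWith_one_max_zero : LipschitzWith 1 fun x : ℝ => max x 0 :=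
  LipschitzWith.id.max_const 0

lemma LipschitzWith.integrable_comp_sub {α : Type*} [MeasurableSpace α] {μ : Measure α}
    [IsFiniteMeasure μ] {k : ℝ → ℝ} (hk : LipschitzWith 1 k) {g : α → ℝ} (hg : Integrable g μ)
    (x : ℝ) : Integrable (fun y => k (x - g y)) μ := by
  refine ((integrable_const |k x|).add hg.norm).mono'
    (hk.continuous.comp_aestronglyMeasurable (aestronglyMeasurable_const.sub hg.aestronglyMeasurable))
    (ae_of_all _ fun y => ?_)
  have h := hk.dist_le_mul (x - g y) x
  rw [Real.dist_eq, Real.dist_eq] at h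
  have h2 := abs_sub_abs_le_abs_sub (k (x - g y)) (k x)
  simp only [NNReal.coe_one, one_mul, sub_sub_cancel_left, abs_neg] at h
  simp only [Pi.add_apply, Real.norm_eq_abs]
  linarith

lemma LipschitzWith.integral_comp_sub {α : Type*} [MeasurableSpace α] {μ : Measure α}
    [IsProbabilityMeasure μ] {k : ℝ → ℝ} (hk : LipschitzWith 1 k) {g : α → ℝ}
    (hg : Integrable g μ) : LipschitzWith 1 fun x => ∫ y, k (x - g y) ∂μ := by
  refine LipschitzWith.of_dist_le_mul fun x y => ?_
  rw [Real.dist_eq, ← integral_sub (hk.integrable_comp_sub hg x) (hk.integrable_comp_sub hg y),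
    ← Real.norm_eq_abs]
  refine (norm_integral_le_of_norm_le_const (C := dist x y) (ae_of_all _ fun z => ?_)).trans_eq ?_
  · have h := hk.dist_le_mul (x - g z) (y - g z)
    rwa [dist_sub_right, NNReal.coe_one, one_mul, Real.dist_eq] at h
  · simp

lemma integral_expMeasure_comp_add {k : ℝ → ℝ} (hk : LipschitzWith 1 k) {s d : ℝ} (hs : 0 < s)
    (hd : 0 ≤ d) (x : ℝ) :
    ∫ y, k (x + d - s * y) ∂expMeasure 1 =
      (∫ t in Set.Ioc 0 (d / s), exp (-t) * k (x + d - s * t)) +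
        exp (-(d / s)) * ∫ y, k (x - s * y) ∂expMeasure 1 := by
  have hI := integrable_expMeasure_iff.1
    (hk.integrable_comp_sub (integrable_id_expMeasure.const_mul s) (x + d))
  have hb : 0 ≤ d / s := by positivity
  simp only [smul_eq_mul] at hI
  simp only [integral_expMeasure, smul_eq_mul]
  rw [← Set.Ioc_union_Ioi_eq_Ioi hb, setIntegral_union (by simp) measurableSet_Ioi
    (hI.mono_set Set.Ioc_subset_Ioi_self) (hI.mono_set (Set.Ioi_subset_Ioi hb)),
    Set.Ioc_union_Ioi_eq_Ioi hb, ← integral_const_mul]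
  congr 1
  have := (measurePreserving_add_right volume (d / s)).setIntegral_preimage_emb
    (measurableEmbedding_addRight (d / s)) (fun t => exp (-t) * k (x + d - s * t))
    (Set.Ioi (d / s))
  rw [← this]
  simp only [Set.preimage_add_const_Ioi, sub_self]
  refine setIntegral_congr_fun measurableSet_Ioi fun t _ => ?_
  rw [← mul_assoc, ← exp_add]
  congr 2
  · ring
  · field_simp
    ring

lemma IncrementLogConcave.integral_expMeasure_of_pos {k : ℝ → ℝ} (hk : IncrementLogConcave k)
    (hL : LipschitzWith 1 k) {s : ℝ} (hs : 0 < s) :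
    IncrementLogConcave fun x => ∫ y, k (x - s * y) ∂expMeasure 1 := by
  intro w x d hwx hd
  dsimp only
  rw [integral_expMeasure_comp_add hL hs hd, integral_expMeasure_comp_add hL hs hd]
  have hi (z : ℝ) := hL.integrable_comp_sub (integrable_id_expMeasure.const_mul s) z
  have key : (∫ t in Set.Ioc 0 (d / s), exp (-t) * k (x + d - s * t)) *
        (∫ y, k (w - s * y) ∂expMeasure 1) ≤
      (∫ t in Set.Ioc 0 (d / s), exp (-t) * k (w + d - s * t)) *
        (∫ y, k (x - s * y) ∂expMeasure 1) := by
    have hc := hL.continuous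
    have hint (z v : ℝ) : IntegrableOn
        (fun t => exp (-t) * k (z + d - s * t) * ∫ y, k (v - s * y) ∂expMeasure 1)
        (Set.Ioc 0 (d / s)) :=
      (Continuous.integrableOn_Icc (by fun_prop)).mono_set Set.Ioc_subset_Icc_self
    rw [← integral_mul_const, ← integral_mul_const]
    refine setIntegral_mono_on (hint x w) (hint w x) measurableSet_Ioc fun t ht => ?_
    rw [mul_assoc, mul_assoc]
    refine mul_le_mul_of_nonneg_left ?_ (exp_pos _).le
    rw [← integral_const_mul, ← integral_const_mul]
    refine integral_mono_ae ((hi w).const_mul _) ((hi x).const_mul _) ?_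
    have hpos : ∀ᵐ y ∂expMeasure 1, 0 < y := by
      rw [expMeasure_one_eq]
      exact (withDensity_absolutelyContinuous _ _).ae_le (ae_restrict_mem measurableSet_Ioi)
    filter_upwards [hpos] with y hy
    have h1 : s * t ≤ d := by
      have := ht.2
      rwa [le_div_iff₀' hs] at this
    have h2 : 0 ≤ s * y := by positivity
    have := hk (w - s * y) (x - s * y) (d - s * t + s * y) (by linarith) (by linarith)
    rw [show x - s * y + (d - s * t + s * y) = x + d - s * t by ring,
      show w - s * y + (d - s * t + s * y) = w + d - s * t by ring] at this
    linarith
  linarith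

lemma IncrementLogConcave.integral_expMeasure {k : ℝ → ℝ} (hk : IncrementLogConcave k)
    (hL : LipschitzWith 1 k) (s : ℝ) :
    IncrementLogConcave fun x => ∫ y, k (x - s * y) ∂expMeasure 1 := by
  rcases lt_trichotomy s 0 with hs | rfl | hs
  · have h := (hk.comp_neg.integral_expMeasure_of_pos
      (by simpa using! hL.comp LipschitzWith.id.neg) (neg_pos.2 hs)).comp_neg
    simpa [sub_eq_add_neg, add_comm] using h
  · simpa using hk
  · exact hk.integral_expMeasure_of_pos hL hs

lemma integrable_sum_pi_expMeasure {m : ℕ} (a : Fin m → ℝ) :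
    Integrable (fun x : Fin m → ℝ => ∑ j, a j * x j) (Measure.pi fun _ => expMeasure 1) :=
  integrable_finsetSum _ fun j _ =>
    (integrable_comp_eval (μ := fun _ => expMeasure 1) integrable_id_expMeasure).const_mul (a j)

lemma integral_sum_pi_expMeasure {m : ℕ} (a : Fin m → ℝ) :
    ∫ x : Fin m → ℝ, ∑ j, a j * x j ∂(Measure.pi fun _ => expMeasure 1) = ∑ j, a j := by
  have hi (j : Fin m) : Integrable (fun x : Fin m → ℝ => x j)
      (Measure.pi fun _ => expMeasure 1) :=
    integrable_comp_eval (μ := fun _ => expMeasure 1) integrable_id_expMeasure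
  rw [integral_finsetSum _ fun j _ => (hi j).const_mul (a j)]
  refine Finset.sum_congr rfl fun j _ => ?_
  rw [integral_const_mul, integral_comp_eval (μ := fun _ => expMeasure 1) (f := fun x : ℝ => x)
    (by fun_prop), integral_id_expMeasure, mul_one]

lemma IncrementLogConcave.integral_pi_expMeasure {m : ℕ} (a : Fin m → ℝ) {k : ℝ → ℝ}
    (hk : IncrementLogConcave k) (hL : LipschitzWith 1 k) :
    IncrementLogConcave fun x =>
      ∫ y : Fin m → ℝ, k (x - ∑ j, a j * y j) ∂(Measure.pi fun _ => expMeasure 1) := by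
  induction m with
  | zero => simpa using hk
  | succ m ih =>
    have h := (ih (fun j => a j.succ)).integral_expMeasure
      (hL.integral_comp_sub (integrable_sum_pi_expMeasure fun j => a j.succ)) (a 0)
    convert h using 2 with x
    have hmp := measurePreserving_piFinSuccAbove (fun _ : Fin (m + 1) => expMeasure 1) 0
    have hI := hL.integrable_comp_sub (integrable_sum_pi_expMeasure a) x
    rw [← hmp.symm.integral_comp' (g := fun y => k (x - ∑ j, a j * y j)), integral_prod]
    · simp [Fin.sum_univ_succ, sub_sub]
    · exact (hmp.symm.integrable_comp_emb (MeasurableEquiv.measurableEmbedding _)).2 hI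

/-- Second-order expansion of `x ↦ ∫ (x - z)⁺ q(z) dz` at the origin, as a lower bound: half of
the square of the step times a lower bound of the density. -/
lemma le_integral_max_sub {q : ℝ → ℝ} (hq : Continuous q) (hq0 : ∀ z, 0 ≤ q z)
    (hi : Integrable q) (hi1 : Integrable fun z => z * q z) {c d : ℝ}
    (hc : ∀ z ∈ Set.Icc (-|d|) |d|, c ≤ q z) :
    (∫ z, max (0 - z) 0 * q z) + d * (∫ z in Set.Iic 0, q z) + c * (d ^ 2 / 2) ≤
      ∫ z, max (d - z) 0 * q z := by
  have hmax (x : ℝ) : Integrable fun z => max (x - z) 0 * q z := by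
    refine ((hi.const_mul |x|).add hi1.norm).mono' (by fun_prop) (ae_of_all _ fun z => ?_)
    have : |max (x - z) 0| ≤ |x| + |z| := by
      rw [abs_of_nonneg (le_max_right _ _)]
      exact max_le ((le_abs_self _).trans (abs_sub _ _)) (by positivity)
    simp only [Pi.add_apply, norm_mul, Real.norm_eq_abs, abs_of_nonneg (hq0 z)]
    nlinarith [hq0 z]
  have hind : ∫ z in Set.Iic 0, q z = ∫ z, (Set.Iic (0 : ℝ)).indicator q z :=
    (integral_indicator measurableSet_Iic).symm
  have hindi : Integrable ((Set.Iic (0 : ℝ)).indicator q) := hi.indicator measurableSet_Iic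
  have hquad : c * (d ^ 2 / 2) = ∫ z, (Set.uIoc 0 d).indicator (fun z => |d - z| * c) z := by
    rw [integral_indicator measurableSet_uIoc]
    rcases le_total 0 d with hd | hd
    · rw [Set.uIoc_of_le hd, ← intervalIntegral.integral_of_le hd,
        intervalIntegral.integral_congr (g := fun z => (d - z) * c)
        (fun z hz => by
          rw [Set.uIcc_of_le hd] at hz
          simp only [abs_of_nonneg (sub_nonneg.2 hz.2)])]
      rw [intervalIntegral.integral_mul_const,
        intervalIntegral.integral_sub (by simp) (by simp)]
      simp
      ring
    · rw [Set.uIoc_of_ge hd, ← intervalIntegral.integral_of_le hd,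
        intervalIntegral.integral_congr (g := fun z => (z - d) * c)
        (fun z hz => by
          rw [Set.uIcc_of_le hd] at hz
          simp only [abs_of_nonpos (sub_nonpos.2 hz.1), neg_sub])]
      rw [intervalIntegral.integral_mul_const,
        intervalIntegral.integral_sub (by simp) (by simp)]
      simp
      ring
  have hquadi : Integrable ((Set.uIoc 0 d).indicator (fun z => |d - z| * c)) := by
    rw [integrable_indicator_iff measurableSet_uIoc]
    exact (Continuous.integrableOn_uIcc (by fun_prop)).mono_set Set.uIoc_subset_uIcc
  have hlin : Integrable fun z => max (0 - z) 0 * q z + d * (Set.Iic (0 : ℝ)).indicator q z :=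
    (hmax 0).add (hindi.const_mul d)
  rw [hind, hquad, ← integral_const_mul, ← integral_add (hmax 0) (hindi.const_mul d),
    ← integral_add hlin hquadi]
  refine integral_mono (hlin.add hquadi) (hmax d) fun z => ?_
  classical
  rw [Set.indicator_apply (Set.uIoc 0 d), Set.indicator_apply]
  simp only [Set.mem_Iic, Set.mem_uIoc]
  have hz0 := hq0 z
  rcases le_total 0 d with hd | hd
  · rw [abs_of_nonneg hd] at hc
    rcases le_or_gt z 0 with hz | hz
    · rw [if_pos hz, if_neg (by grind), max_eq_left (by linarith), max_eq_left (by linarith)]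
      linarith
    · rw [if_neg hz.not_ge, max_eq_right (by linarith)]
      rcases le_or_gt z d with h | h
      · rw [if_pos (by grind), max_eq_left (by linarith), abs_of_nonneg (by linarith)]
        nlinarith [hc z ⟨by linarith, h⟩]
      · rw [if_neg (by grind), max_eq_right (by linarith)]
        linarith
  · rw [abs_of_nonpos hd, neg_neg] at hc
    rcases le_or_gt z d with hz | hz
    · rw [if_pos (by linarith), if_neg (by grind), max_eq_left (by linarith),
        max_eq_left (by linarith)]
      linarith
    · rw [max_eq_right (by linarith : d - z ≤ 0)]
      rcases le_or_gt z 0 with h | h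
      · rw [if_pos h, if_pos (by grind), max_eq_left (by linarith), abs_of_nonpos (by linarith)]
        nlinarith [hc z ⟨hz.le, by linarith⟩]
      · rw [if_neg h.not_ge, if_neg (by grind), max_eq_right (by linarith)]
        linarith

/-- If the second antiderivative `G` of a density `q` is log-concave, then `G * q ≤ (G')²` at the
origin. -/
lemma IncrementLogConcave.mul_density_le {q : ℝ → ℝ} (hq : Continuous q) (hq0 : ∀ z, 0 ≤ q z)
    (hi : Integrable q) (hi1 : Integrable fun z => z * q z)
    (hG : IncrementLogConcave fun x => ∫ z, max (x - z) 0 * q z) :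
    (∫ z, max (0 - z) 0 * q z) * q 0 ≤ (∫ z in Set.Iic 0, q z) ^ 2 := by
  set G := ∫ z, max (0 - z) 0 * q z with hGdef
  set F := ∫ z in Set.Iic 0, q z with hFdef
  have hG0 : 0 ≤ G := integral_nonneg fun z => mul_nonneg (le_max_right _ _) (hq0 z)
  have hF0 : 0 ≤ F := integral_nonneg hq0
  rcases hG0.eq_or_lt with h | hGpos
  · rw [← h, zero_mul]; positivity
  rcases (hq0 0).eq_or_lt with h | hqpos
  · rw [← h, mul_zero]; positivity
  have key : ∀ c, 0 < c → c < q 0 → G * c ≤ F ^ 2 := by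
    intro c hc0 hc
    obtain ⟨δ, hδ, hball⟩ := Metric.eventually_nhds_iff_ball.1
      (hq.continuousAt.eventually (lt_mem_nhds hc))
    obtain ⟨d, hd0, hd⟩ := exists_between (lt_min hδ (by positivity : 0 < G / (F + 1)))
    rw [lt_min_iff, lt_div_iff₀ (by positivity)] at hd
    have hc' : ∀ z ∈ Set.Icc (-d) d, c ≤ q z := fun z hz => by
      refine (hball z ?_).le
      rw [Metric.mem_ball, dist_zero_right, Real.norm_eq_abs]
      exact (abs_le.2 hz).trans_lt hd.1
    have h1 := le_integral_max_sub hq hq0 hi hi1 (d := d) (c := c) (by rwa [abs_of_pos hd0])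
    have h2 := le_integral_max_sub hq hq0 hi hi1 (d := -d) (c := c)
      (by rwa [abs_neg, abs_of_pos hd0])
    have h3 := hG (-d) 0 d (by linarith) hd0.le
    simp only [zero_add, neg_add_cancel, ← hGdef, ← hFdef] at h1 h2 h3
    have h4 : 0 ≤ G + -d * F + c * ((-d) ^ 2 / 2) := by nlinarith [sq_nonneg d]
    have h5 := mul_le_mul h1 h2 h4 (by
      refine le_trans ?_ h1
      positivity)
    have h6 : d ^ 2 * (G * c - F ^ 2) ≤ 0 := by nlinarith [sq_nonneg (c * d ^ 2)]
    have h7 : 0 < d ^ 2 := by positivity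
    nlinarith
  by_contra! hlt
  have h1 : F ^ 2 / G < q 0 := by rwa [div_lt_iff₀' hGpos]
  obtain ⟨c, hc1, hc2⟩ := exists_between h1
  have hc0 : 0 < c := lt_of_le_of_lt (by positivity) hc1
  have := key c hc0 hc2
  rw [div_lt_iff₀' hGpos] at hc1
  linarith

section ExpSumDensity

variable {m : ℕ} {a : Fin m → ℝ} {p : ℝ → ℝ}

lemma IsExpSumDensity.max_zero (hp : IsExpSumDensity a p) :
    IsExpSumDensity a fun z => max (p z) 0 := by
  refine ⟨hp.1.max continuous_const, hp.2.trans ?_⟩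
  congr 1
  ext z
  simp [ENNReal.ofReal_max]

lemma IsExpSumDensity.neg (hp : IsExpSumDensity a p) :
    IsExpSumDensity (fun j => -a j) fun z => p (-z) := by
  refine ⟨hp.1.comp continuous_neg, ?_⟩
  have h : (fun x : Fin m → ℝ => ∑ j, -a j * x j) = Neg.neg ∘ fun x => ∑ j, a j * x j := by
    ext x; simp
  rw [h, ← Measure.map_map measurable_neg (by fun_prop), hp.2]
  have hm : Measurable fun z => ENNReal.ofReal (p z) := hp.1.measurable.ennreal_ofReal
  ext s hs
  rw [Measure.map_apply measurable_neg hs, withDensity_apply _ (measurable_neg hs),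
    withDensity_apply _ hs]
  have := (Measure.measurePreserving_neg (volume : Measure ℝ)).setLIntegral_comp_preimage
    (measurable_neg hs) hm
  rw [← this]
  simp

lemma IsExpSumDensity.lintegral_comp (hp : IsExpSumDensity a p) {g : ℝ → ENNReal}
    (hg : Measurable g) :
    ∫⁻ x : Fin m → ℝ, g (∑ j, a j * x j) ∂(Measure.pi fun _ => expMeasure 1) =
      ∫⁻ z, ENNReal.ofReal (p z) * g z := by
  rw [← lintegral_map hg (by fun_prop), hp.2,
    lintegral_withDensity_eq_lintegral_mul _ hp.1.measurable.ennreal_ofReal hg]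
  rfl

variable {E : Type*} [NormedAddCommGroup E] [NormedSpace ℝ E]

lemma IsExpSumDensity.integral_comp (hp : IsExpSumDensity a p) (hp0 : ∀ z, 0 ≤ p z) {f : ℝ → E}
    (hf : StronglyMeasurable f) :
    ∫ x : Fin m → ℝ, f (∑ j, a j * x j) ∂(Measure.pi fun _ => expMeasure 1) =
      ∫ z, p z • f z := by
  rw [← integral_map (Measurable.aemeasurable (by fun_prop)) hf.aestronglyMeasurable, hp.2,
    integral_withDensity_eq_integral_toReal_smul hp.1.measurable.ennreal_ofReal (by simp)]
  simp [ENNReal.toReal_ofReal (hp0 _)]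

lemma IsExpSumDensity.integrable_comp_iff (hp : IsExpSumDensity a p) (hp0 : ∀ z, 0 ≤ p z)
    {f : ℝ → E} (hf : StronglyMeasurable f) :
    Integrable (fun x : Fin m → ℝ => f (∑ j, a j * x j)) (Measure.pi fun _ => expMeasure 1) ↔
      Integrable fun z => p z • f z := by
  rw [← Function.comp_def f, ← integrable_map_measure hf.aestronglyMeasurable
    (Measurable.aemeasurable (by fun_prop)), hp.2,
    integrable_withDensity_iff_integrable_smul' hp.1.measurable.ennreal_ofReal (by simp)]
  simp [ENNReal.toReal_ofReal (hp0 _)]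

lemma IsExpSumDensity.integrable (hp : IsExpSumDensity a p) (hp0 : ∀ z, 0 ≤ p z) :
    Integrable p := by
  simpa using (hp.integrable_comp_iff hp0 (f := fun _ => (1 : ℝ))
    stronglyMeasurable_const).1 (integrable_const _)

lemma IsExpSumDensity.integral_eq_one (hp : IsExpSumDensity a p) (hp0 : ∀ z, 0 ≤ p z) :
    ∫ z, p z = 1 := by
  simpa using (hp.integral_comp hp0 (f := fun _ => (1 : ℝ)) stronglyMeasurable_const).symm

lemma IsExpSumDensity.integrable_mul (hp : IsExpSumDensity a p) (hp0 : ∀ z, 0 ≤ p z) :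
    Integrable fun z => z * p z := by
  simpa [mul_comm] using (hp.integrable_comp_iff hp0 (f := fun z => z)
    stronglyMeasurable_id).1 (integrable_sum_pi_expMeasure a)

lemma IsExpSumDensity.integral_mul (hp : IsExpSumDensity a p) (hp0 : ∀ z, 0 ≤ p z) :
    ∫ z, z * p z = ∑ j, a j := by
  rw [← integral_sum_pi_expMeasure a, hp.integral_comp hp0 (f := fun z => z) stronglyMeasurable_id]
  simp [mul_comm]

lemma IsExpSumDensity.incrementLogConcave (hp : IsExpSumDensity a p) (hp0 : ∀ z, 0 ≤ p z) :
    IncrementLogConcave fun x => ∫ z, max (x - z) 0 * p z := by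
  convert incrementLogConcave_max_zero.integral_pi_expMeasure a lipschitzWith_one_max_zero
    using 2 with x
  rw [hp.integral_comp hp0 (f := fun z => max (x - z) 0)
    (Continuous.stronglyMeasurable (by fun_prop))]
  simp [mul_comm]

end ExpSumDensity

lemma lintegral_pi_expMeasure_eq {n : ℕ} (a : Fin (n + 1) → ℝ) (i : Fin (n + 1))
    {g : ℝ → ENNReal} (hg : Measurable g) :
    ∫⁻ x : Fin (n + 1) → ℝ, g (∑ j, a j * x j) ∂(Measure.pi fun _ => expMeasure 1) =
      ∫⁻ x : Fin n → ℝ, ∫⁻ y, g (a i * y + ∑ j, a (i.succAbove j) * x j) ∂expMeasure 1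
        ∂(Measure.pi fun _ => expMeasure 1) := by
  have hmp := measurePreserving_piFinSuccAbove (fun _ : Fin (n + 1) => expMeasure 1) i
  have hm : Measurable fun x : Fin (n + 1) → ℝ => g (∑ j, a j * x j) := hg.comp (by fun_prop)
  rw [← hmp.symm.lintegral_comp hm, lintegral_prod_symm']
  swap
  · exact hm.comp (MeasurableEquiv.measurable _)
  simp [Fin.sum_univ_succAbove _ i]

lemma lintegral_indicator_Ioi_affine {s : ℝ} (hs : 0 < s) (r : ℝ) :
    ∫⁻ y, (Set.Ioi 0).indicator 1 (s * y + r) ∂expMeasure 1 = expMeasure 1 (Set.Ioi (-r / s)) := by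
  rw [← lintegral_indicator_one measurableSet_Ioi]
  congr! 2 with y
  simp only [Set.indicator_apply, Set.mem_Ioi, Pi.one_apply, div_lt_iff₀' hs, neg_lt_iff_pos_add]

lemma lintegral_indicator_Ioc_affine_le {s : ℝ} (hs : 0 < s) (r d : ℝ) :
    ∫⁻ y, (Set.Ioc 0 d).indicator 1 (s * y + r) ∂expMeasure 1 ≤
      ENNReal.ofReal (d / s) * ∫⁻ y, (Set.Ioi 0).indicator 1 (s * y + r) ∂expMeasure 1 := by
  have h : ∫⁻ y, (Set.Ioc 0 d).indicator 1 (s * y + r) ∂expMeasure 1 =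
      expMeasure 1 (Set.Ioc (-r / s) ((d - r) / s)) := by
    rw [← lintegral_indicator_one measurableSet_Ioc]
    congr! 2 with y
    simp only [Set.indicator_apply, Set.mem_Ioc, Pi.one_apply, div_lt_iff₀' hs, neg_lt_iff_pos_add,
      le_div_iff₀' hs, le_sub_iff_add_le]
  rw [h, lintegral_indicator_Ioi_affine hs]
  convert expMeasure_Ioc_le (-r / s) ((d - r) / s) using 3
  ring

lemma mul_lintegral_indicator_Ioi_affine_le {s : ℝ} (hs : 0 < s) (r : ℝ) :
    ENNReal.ofReal s * ∫⁻ y, (Set.Ioi 0).indicator 1 (s * y + r) ∂expMeasure 1 ≤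
      ∫⁻ y, ENNReal.ofReal (s * y + r) ∂expMeasure 1 := by
  rw [lintegral_indicator_Ioi_affine hs]
  refine (mul_le_mul_right (expMeasure_Ioi_le_lintegral (-r / s)) _).trans_eq ?_
  rw [← lintegral_const_mul _ (by fun_prop)]
  congr! 2 with y
  rw [← ENNReal.ofReal_mul hs.le]
  congr 1
  field_simp
  ring

section LargeCoefficient

variable {n : ℕ} {a : Fin (n + 1) → ℝ} {p : ℝ → ℝ} {i : Fin (n + 1)}

lemma IsExpSumDensity.setIntegral_Ioc_le (hp : IsExpSumDensity a p) (hp0 : ∀ z, 0 ≤ p z)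
    (hi : 0 < a i) {d : ℝ} (hd : 0 ≤ d) :
    ∫ z in Set.Ioc 0 d, p z ≤ d / a i * ∫ z in Set.Ioi 0, p z := by
  have hconv {s : Set ℝ} (hs : MeasurableSet s) :
      ∫⁻ x : Fin (n + 1) → ℝ, s.indicator 1 (∑ j, a j * x j)
        ∂(Measure.pi fun _ => expMeasure 1) = ENNReal.ofReal (∫ z in s, p z) := by
    rw [hp.lintegral_comp (measurable_one.indicator hs),
      ofReal_integral_eq_lintegral_ofReal (hp.integrable hp0).integrableOn (ae_of_all _ hp0),
      ← lintegral_indicator hs]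
    refine lintegral_congr fun z => ?_
    by_cases hz : z ∈ s <;> simp [hz]
  have h : ∫⁻ x : Fin (n + 1) → ℝ, (Set.Ioc 0 d).indicator 1 (∑ j, a j * x j)
        ∂(Measure.pi fun _ => expMeasure 1) ≤
      ENNReal.ofReal (d / a i) * ∫⁻ x : Fin (n + 1) → ℝ, (Set.Ioi 0).indicator 1 (∑ j, a j * x j)
        ∂(Measure.pi fun _ => expMeasure 1) := by
    rw [lintegral_pi_expMeasure_eq a i (measurable_one.indicator measurableSet_Ioc),
      lintegral_pi_expMeasure_eq a i (measurable_one.indicator measurableSet_Ioi),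
      ← lintegral_const_mul' _ _ ENNReal.ofReal_ne_top]
    exact lintegral_mono fun x => lintegral_indicator_Ioc_affine_le hi _ d
  rw [hconv measurableSet_Ioc, hconv measurableSet_Ioi, ← ENNReal.ofReal_mul (by positivity)] at h
  exact (ENNReal.ofReal_le_ofReal_iff
    (mul_nonneg (by positivity) (integral_nonneg hp0))).1 h

lemma IsExpSumDensity.mul_setIntegral_Ioi_le (hp : IsExpSumDensity a p) (hp0 : ∀ z, 0 ≤ p z)
    (hi : 0 < a i) :
    a i * ∫ z in Set.Ioi 0, p z ≤ ∫ z, max z 0 * p z := by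
  have h : ENNReal.ofReal (a i) *
        ∫⁻ x : Fin (n + 1) → ℝ, (Set.Ioi 0).indicator 1 (∑ j, a j * x j)
          ∂(Measure.pi fun _ => expMeasure 1) ≤
      ∫⁻ x : Fin (n + 1) → ℝ, ENNReal.ofReal (∑ j, a j * x j)
        ∂(Measure.pi fun _ => expMeasure 1) := by
    rw [lintegral_pi_expMeasure_eq a i (measurable_one.indicator measurableSet_Ioi),
      lintegral_pi_expMeasure_eq a i (g := ENNReal.ofReal) (by fun_prop),
      ← lintegral_const_mul' _ _ ENNReal.ofReal_ne_top]
    exact lintegral_mono fun x => mul_lintegral_indicator_Ioi_affine_le hi _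
  have hL : ∫⁻ z, ENNReal.ofReal (p z) * (Set.Ioi (0 : ℝ)).indicator 1 z =
      ENNReal.ofReal (∫ z in Set.Ioi 0, p z) := by
    rw [ofReal_integral_eq_lintegral_ofReal (hp.integrable hp0).integrableOn (ae_of_all _ hp0),
      ← lintegral_indicator measurableSet_Ioi]
    refine lintegral_congr fun z => ?_
    by_cases hz : z ∈ Set.Ioi (0 : ℝ) <;> simp [hz]
  have hmi : Integrable fun z => max z 0 * p z := by
    refine (hp.integrable_mul hp0).norm.mono'
      (by have := hp.1; fun_prop) (ae_of_all _ fun z => ?_)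
    rw [norm_mul, norm_mul]
    refine mul_le_mul_of_nonneg_right ?_ (norm_nonneg _)
    rw [Real.norm_eq_abs, abs_of_nonneg (le_max_right _ _)]
    exact max_le (le_abs_self _) (norm_nonneg _)
  have hR : ∫⁻ z, ENNReal.ofReal (p z) * ENNReal.ofReal z =
      ENNReal.ofReal (∫ z, max z 0 * p z) := by
    rw [ofReal_integral_eq_lintegral_ofReal hmi
      (ae_of_all _ fun z => mul_nonneg (le_max_right _ _) (hp0 z))]
    refine lintegral_congr fun z => ?_
    rw [ENNReal.ofReal_mul (le_max_right _ _), mul_comm, ENNReal.ofReal_max]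
    simp
  rw [hp.lintegral_comp (measurable_one.indicator measurableSet_Ioi),
    hp.lintegral_comp (g := ENNReal.ofReal) (by fun_prop), hL, hR,
    ← ENNReal.ofReal_mul hi.le] at h
  exact (ENNReal.ofReal_le_ofReal_iff
    (integral_nonneg fun z => mul_nonneg (le_max_right _ _) (hp0 z))).1 h

/-- A positive coefficient `s` forces the density at the mean to be at most `1 / (2 s)`. -/
lemma IsExpSumDensity.mul_apply_zero_le_half (hp : IsExpSumDensity a p) (hp0 : ∀ z, 0 ≤ p z)
    (hsum : ∑ j, a j = 0) (hi : 0 < a i) : a i * p 0 ≤ 1 / 2 := by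
  set s := a i with hs
  set u := ∫ z in Set.Ioi 0, p z with hu
  have hF : ∫ z in Set.Iic 0, p z = 1 - u := by
    rw [← hp.integral_eq_one hp0, ← intervalIntegral.integral_Iic_add_Ioi
      (hp.integrable hp0).integrableOn (hp.integrable hp0).integrableOn (b := 0)]
    ring
  have hF0 : 0 ≤ 1 - u := hF ▸ integral_nonneg hp0
  have hu0 : 0 ≤ u := integral_nonneg hp0
  have hmu : s * p 0 ≤ u := by
    by_contra! hlt
    have h1 : u / s < p 0 := by rwa [div_lt_iff₀' hi]
    obtain ⟨c, hc1, hc2⟩ := exists_between h1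
    obtain ⟨δ, hδ, hball⟩ := Metric.eventually_nhds_iff_ball.1
      (hp.1.continuousAt.eventually (lt_mem_nhds hc2))
    have h2 := hp.setIntegral_Ioc_le hp0 hi (d := δ / 2) (by positivity)
    have h3 : ∫ z in Set.Ioc 0 (δ / 2), c ≤ ∫ z in Set.Ioc 0 (δ / 2), p z := by
      refine setIntegral_mono_on (by simp) (hp.integrable hp0).integrableOn measurableSet_Ioc
        fun z hz => (hball z ?_).le
      rw [Metric.mem_ball, dist_zero_right, Real.norm_eq_abs, abs_of_pos hz.1]
      linarith [hz.2]
    rw [setIntegral_const, Real.volume_real_Ioc_of_le (by positivity), smul_eq_mul] at h3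
    rw [div_lt_iff₀' hi] at hc1
    have h4 := h3.trans h2
    rw [div_mul_eq_mul_div, le_div_iff₀ hi, ← hu] at h4
    nlinarith
  have hG : s * u ≤ ∫ z, max (0 - z) 0 * p z := by
    have h1 := hp.mul_setIntegral_Ioi_le hp0 hi
    have h2 : ∫ z, z * p z = (∫ z, max z 0 * p z) - ∫ z, max (0 - z) 0 * p z := by
      have hmax (c : ℝ) : Integrable fun z => max (c * z) 0 * p z := by
        refine ((hp.integrable_mul hp0).norm.const_mul |c|).mono'
          (by have := hp.1; fun_prop) (ae_of_all _ fun z => ?_)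
        rw [norm_mul, norm_mul, ← mul_assoc]
        refine mul_le_mul_of_nonneg_right ?_ (norm_nonneg _)
        rw [Real.norm_eq_abs, Real.norm_eq_abs, abs_of_nonneg (le_max_right _ _), ← abs_mul]
        exact max_le (le_abs_self _) (abs_nonneg _)
      rw [← integral_sub (by simpa using hmax 1) (by simpa using hmax (-1))]
      refine integral_congr_ae (ae_of_all _ fun z => ?_)
      dsimp only
      rw [← sub_mul, zero_sub, max_zero_sub_max_neg_zero_eq_self]
    rw [hp.integral_mul hp0, hsum] at h2
    linarith
  have hkey := (hp.incrementLogConcave hp0).mul_density_le hp.1 hp0 (hp.integrable hp0)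
    (hp.integrable_mul hp0)
  rw [hF] at hkey
  have h5 := mul_le_mul_of_nonneg_right hG (hp0 0)
  have h6 := hp0 0
  by_contra! hlt
  nlinarith

end LargeCoefficient

section Fourier

open FourierTransform

lemma IsExpSumDensity.fourier_eq {m : ℕ} {a : Fin m → ℝ} {p : ℝ → ℝ} (hp : IsExpSumDensity a p)
    (hp0 : ∀ z, 0 ≤ p z) (w : ℝ) :
    𝓕 (fun z => (p z : ℂ)) w = ∏ j, (1 + 2 * π * w * a j * Complex.I)⁻¹ := by
  have hf : StronglyMeasurable fun z : ℝ => Complex.exp (↑(-2 * π * z * w) * Complex.I) :=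
    Continuous.stronglyMeasurable (by fun_prop)
  have h := hp.integral_comp hp0 hf
  rw [Real.fourier_real_eq_integral_exp_smul]
  trans ∫ z, p z • Complex.exp (↑(-2 * π * z * w) * Complex.I)
  · refine integral_congr_ae (ae_of_all _ fun z => ?_)
    simp [mul_comm]
  rw [← h]
  trans ∫ x : Fin m → ℝ, ∏ j, Complex.exp ((-2 * π * w * a j : ℝ) * x j * Complex.I)
      ∂(Measure.pi fun _ => expMeasure 1)
  · refine integral_congr_ae (ae_of_all _ fun x => ?_)
    dsimp only
    rw [← Complex.exp_sum]
    congr 1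
    push_cast
    rw [Finset.mul_sum, Finset.sum_mul, Finset.sum_mul]
    refine Finset.sum_congr rfl fun j _ => ?_
    ring
  rw [integral_fintype_prod_eq_prod (𝕜 := ℂ)
    (f := fun j (y : ℝ) => Complex.exp ((-2 * π * w * a j : ℝ) * y * Complex.I))]
  refine Finset.prod_congr rfl fun j _ => ?_
  rw [integral_cexp_expMeasure]
  congr 1
  push_cast
  ring

lemma IsExpSumDensity.apply_zero_eq {m : ℕ} {a : Fin m → ℝ} {p : ℝ → ℝ}
    (hp : IsExpSumDensity a p) (hp0 : ∀ z, 0 ≤ p z)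
    (hint : Integrable fun w : ℝ => ∏ j, (1 + 2 * π * w * a j * Complex.I : ℂ)⁻¹) :
    (p 0 : ℂ) = ∫ w : ℝ, ∏ j, (1 + 2 * π * w * a j * Complex.I : ℂ)⁻¹ := by
  have hF : 𝓕 (fun z => (p z : ℂ)) =
      fun w : ℝ => ∏ j, (1 + 2 * π * w * a j * Complex.I : ℂ)⁻¹ :=
    funext (hp.fourier_eq hp0)
  have h := Continuous.fourierInv_fourier_eq (f := fun z => (p z : ℂ))
    (Complex.continuous_ofReal.comp hp.1) (hp.integrable hp0).ofReal (hF ▸ hint)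
  have h0 := congrFun h 0
  rw [hF, Real.fourierInv_eq'] at h0
  simpa using h0.symm

end Fourier

lemma continuous_prod_inv_one_add_mul_I {m : ℕ} (a : Fin m → ℝ) :
    Continuous fun w : ℝ => ∏ j, (1 + 2 * π * w * a j * Complex.I : ℂ)⁻¹ := by
  refine continuous_finsetProd _ fun j _ => Continuous.inv₀ (by fun_prop) fun w h => ?_
  simpa using congrArg Complex.re h

lemma norm_sq_one_add_mul_I (w c : ℝ) :
    ‖(1 + 2 * π * w * c * Complex.I : ℂ)‖ ^ 2 = 1 + c ^ 2 * (2 * π * w) ^ 2 := by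
  have : (1 + 2 * π * w * c * Complex.I : ℂ) =
      ((1 : ℝ) : ℂ) + ((2 * π * w * c : ℝ) : ℂ) * Complex.I := by
    push_cast; ring
  rw [this, Complex.sq_norm, Complex.normSq_add_mul_I]
  ring

lemma integral_inv_one_add_two_mul_pi_sq :
    ∫ w : ℝ, (1 + 2 * (π * w) ^ 2)⁻¹ = (√2)⁻¹ := by
  have h := Measure.integral_comp_mul_left (fun w : ℝ => (1 + w ^ 2)⁻¹) (√2 * π)
  rw [integral_univ_inv_one_add_sq, abs_of_pos (by positivity), smul_eq_mul, mul_inv,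
    inv_mul_cancel_right₀ pi_ne_zero] at h
  rw [← h]
  congr! 3 with w
  rw [mul_assoc, mul_pow √2, sq_sqrt zero_le_two]

lemma integrable_inv_one_add_two_mul_pi_sq : Integrable fun w : ℝ => (1 + 2 * (π * w) ^ 2)⁻¹ := by
  refine Integrable.of_integral_ne_zero ?_
  rw [integral_inv_one_add_two_mul_pi_sq]
  positivity

section SmallCoefficients

variable {m : ℕ} {a : Fin m → ℝ}

lemma rpow_one_add_le_one_add_sq_mul {c t : ℝ} (hc : c ^ 2 ≤ 1 / 2) :
    (1 + t ^ 2 / 2) ^ (2 * c ^ 2) ≤ 1 + c ^ 2 * t ^ 2 := by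
  have := rpow_one_add_le_one_add_mul_self (s := t ^ 2 / 2) (p := 2 * c ^ 2)
    (by nlinarith [sq_nonneg t]) (by positivity) (by linarith)
  linarith

lemma rpow_one_add_lt_one_add_sq_mul {c t : ℝ} (hc0 : c ≠ 0) (hc : c ^ 2 < 1 / 2) (ht : t ≠ 0) :
    (1 + t ^ 2 / 2) ^ (2 * c ^ 2) < 1 + c ^ 2 * t ^ 2 := by
  have := rpow_one_add_lt_one_add_mul_self (s := t ^ 2 / 2) (p := 2 * c ^ 2)
    (by nlinarith [sq_nonneg t]) (by positivity) (by positivity) (by linarith)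
  linarith

lemma prod_rpow_one_add (hsq : ∑ j, a j ^ 2 = 1) (t : ℝ) :
    ∏ j, (1 + t ^ 2 / 2) ^ (2 * a j ^ 2) = (1 + t ^ 2 / 2) ^ 2 := by
  rw [← Real.rpow_sum_of_pos (by positivity), ← Finset.mul_sum, hsq, mul_one, Real.rpow_two]

lemma norm_prod_inv_sq (a : Fin m → ℝ) (w : ℝ) :
    ‖∏ j, (1 + 2 * π * w * a j * Complex.I : ℂ)⁻¹‖ ^ 2 =
      (∏ j, (1 + a j ^ 2 * (2 * π * w) ^ 2))⁻¹ := by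
  rw [norm_prod, ← Finset.prod_pow, ← Finset.prod_inv_distrib]
  refine Finset.prod_congr rfl fun j _ => ?_
  rw [norm_inv, inv_pow, norm_sq_one_add_mul_I]

lemma one_add_half_sq (w : ℝ) : 1 + (2 * π * w) ^ 2 / 2 = 1 + 2 * (π * w) ^ 2 := by ring

lemma norm_prod_inv_le (hsq : ∑ j, a j ^ 2 = 1) (ha : ∀ j, a j ^ 2 ≤ 1 / 2) (w : ℝ) :
    ‖∏ j, (1 + 2 * π * w * a j * Complex.I : ℂ)⁻¹‖ ≤ (1 + 2 * (π * w) ^ 2)⁻¹ := by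
  rw [← sq_le_sq₀ (norm_nonneg _) (by positivity), norm_prod_inv_sq, inv_pow, ← one_add_half_sq,
    ← prod_rpow_one_add hsq]
  refine inv_anti₀ (Finset.prod_pos fun j _ => by positivity) ?_
  exact Finset.prod_le_prod (fun j _ => by positivity)
    fun j _ => rpow_one_add_le_one_add_sq_mul (ha j)

lemma norm_prod_inv_lt (hsq : ∑ j, a j ^ 2 = 1) (ha : ∀ j, a j ^ 2 ≤ 1 / 2) {w : ℝ} (hw : w ≠ 0)
    {i : Fin m} (hi0 : a i ≠ 0) (hi : a i ^ 2 ≠ 1 / 2) :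
    ‖∏ j, (1 + 2 * π * w * a j * Complex.I : ℂ)⁻¹‖ < (1 + 2 * (π * w) ^ 2)⁻¹ := by
  rw [← sq_lt_sq₀ (norm_nonneg _) (by positivity), norm_prod_inv_sq, inv_pow, ← one_add_half_sq,
    ← prod_rpow_one_add hsq]
  refine inv_strictAnti₀ (Finset.prod_pos fun j _ => by positivity) ?_
  exact Finset.prod_lt_prod (fun j _ => by positivity)
    (fun j _ => rpow_one_add_le_one_add_sq_mul (ha j))
    ⟨i, Finset.mem_univ i, rpow_one_add_lt_one_add_sq_mul hi0 (lt_of_le_of_ne (ha i) hi)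
      (mul_ne_zero two_pi_pos.ne' hw)⟩

lemma integrable_prod_inv (hsq : ∑ j, a j ^ 2 = 1) (ha : ∀ j, a j ^ 2 ≤ 1 / 2) :
    Integrable fun w : ℝ => ∏ j, (1 + 2 * π * w * a j * Complex.I : ℂ)⁻¹ :=
  integrable_inv_one_add_two_mul_pi_sq.mono'
    (continuous_prod_inv_one_add_mul_I a).aestronglyMeasurable
    (ae_of_all _ (norm_prod_inv_le hsq ha))

variable {p : ℝ → ℝ}

lemma IsExpSumDensity.apply_zero_le_integral_norm (hp : IsExpSumDensity a p)
    (hp0 : ∀ z, 0 ≤ p z) (hsq : ∑ j, a j ^ 2 = 1) (ha : ∀ j, a j ^ 2 ≤ 1 / 2) :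
    p 0 ≤ ∫ w : ℝ, ‖∏ j, (1 + 2 * π * w * a j * Complex.I : ℂ)⁻¹‖ := by
  refine (norm_integral_le_integral_norm _).trans' ?_
  rw [← hp.apply_zero_eq hp0 (integrable_prod_inv hsq ha), Complex.norm_real]
  exact le_norm_self _

lemma IsExpSumDensity.apply_zero_le (hp : IsExpSumDensity a p)
    (hp0 : ∀ z, 0 ≤ p z) (hsq : ∑ j, a j ^ 2 = 1) (ha : ∀ j, a j ^ 2 ≤ 1 / 2) :
    p 0 ≤ (√2)⁻¹ := by
  rw [← integral_inv_one_add_two_mul_pi_sq]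
  exact (hp.apply_zero_le_integral_norm hp0 hsq ha).trans <|
    integral_mono (integrable_prod_inv hsq ha).norm integrable_inv_one_add_two_mul_pi_sq
      (norm_prod_inv_le hsq ha)

lemma IsExpSumDensity.eq_zero_or_sq_eq_half (hp : IsExpSumDensity a p)
    (hp0 : ∀ z, 0 ≤ p z) (hsq : ∑ j, a j ^ 2 = 1) (ha : ∀ j, a j ^ 2 ≤ 1 / 2)
    (heq : p 0 = (√2)⁻¹) (i : Fin m) : a i = 0 ∨ a i ^ 2 = 1 / 2 := by
  by_contra! h
  refine heq.not_lt ?_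
  rw [← integral_inv_one_add_two_mul_pi_sq]
  refine (hp.apply_zero_le_integral_norm hp0 hsq ha).trans_lt ?_
  have hint := integrable_inv_one_add_two_mul_pi_sq.sub (integrable_prod_inv hsq ha).norm
  rw [← sub_pos, ← integral_sub integrable_inv_one_add_two_mul_pi_sq
    (integrable_prod_inv hsq ha).norm]
  refine integral_pos_of_integrable_nonneg_nonzero (x := 1) ?_ hint
    (fun w => sub_nonneg.2 (norm_prod_inv_le hsq ha w))
    (sub_pos.2 (norm_prod_inv_lt hsq ha one_ne_zero h.1 h.2)).ne'
  exact (Continuous.inv₀ (by fun_prop) fun w => by positivity).sub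
    (continuous_prod_inv_one_add_mul_I a).norm

end SmallCoefficients

lemma IsExpSumDensity.apply_zero_eq_of_two {m : ℕ} {a : Fin m → ℝ} {p : ℝ → ℝ}
    (hp : IsExpSumDensity a p) (hp0 : ∀ z, 0 ≤ p z) {j k : Fin m} (hjk : j ≠ k)
    (hj : a j = (√2)⁻¹) (hk : a k = -(√2)⁻¹) (h0 : ∀ i, i ≠ j ∧ i ≠ k → a i = 0) :
    p 0 = (√2)⁻¹ := by
  have h (w : ℝ) : ∏ j, (1 + 2 * π * w * a j * Complex.I : ℂ)⁻¹ =
      ((1 + 2 * (π * w) ^ 2)⁻¹ : ℝ) := by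
    rw [Fintype.prod_eq_mul j k hjk fun i hi => by simp [h0 i hi], hj, hk, ← mul_inv]
    push_cast
    congr 1
    have h2 : ((√2 : ℝ) : ℂ) ^ 2 = 2 := by
      rw [← Complex.ofReal_pow, sq_sqrt zero_le_two, Complex.ofReal_ofNat]
    have h3 : ((√2 : ℝ) : ℂ)⁻¹ ^ 2 = 1 / 2 := by rw [inv_pow, h2, one_div]
    linear_combination (-4 * π ^ 2 * w ^ 2 * Complex.I ^ 2) * h3 - 2 * π ^ 2 * w ^ 2 * Complex.I_sq
  have hint : Integrable fun w : ℝ => ∏ j, (1 + 2 * π * w * a j * Complex.I : ℂ)⁻¹ := by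
    simp_rw [h]
    exact integrable_inv_one_add_two_mul_pi_sq.ofReal (𝕜 := ℂ)
  have h1 := hp.apply_zero_eq hp0 hint
  simp_rw [h] at h1
  rw [integral_complex_ofReal, integral_inv_one_add_two_mul_pi_sq] at h1
  exact_mod_cast h1

lemma exists_pair_of_sq_eq_half {m : ℕ} {a : Fin m → ℝ} (hsum : ∑ j, a j = 0)
    (hsq : ∑ j, a j ^ 2 = 1) (h : ∀ j, a j = 0 ∨ a j ^ 2 = 1 / 2) :
    ∃ j k, j ≠ k ∧ a j = (√2)⁻¹ ∧ a k = -(√2)⁻¹ ∧ ∀ i, i ≠ j ∧ i ≠ k → a i = 0 := by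
  have hne : ∃ i ∈ Finset.univ, a i ≠ 0 := by
    by_contra! h0
    simp [h0] at hsq
  have hhalf : (1 / 2 : ℝ) = (√2)⁻¹ ^ 2 := by rw [inv_pow, sq_sqrt zero_le_two, one_div]
  have hs : (0 : ℝ) < (√2)⁻¹ := by positivity
  obtain ⟨j, -, hj⟩ := Finset.exists_pos_of_sum_zero_of_exists_nonzero a hsum hne
  obtain ⟨k, -, hk⟩ := Finset.exists_pos_of_sum_zero_of_exists_nonzero (s := Finset.univ)
    (fun i => -a i) (by simpa using hsum) (by simpa using hne)
  have hk' : a k < 0 := neg_pos.1 hk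
  have hjk : j ≠ k := by rintro rfl; linarith
  have hj2 := (h j).resolve_left hj.ne'
  have hk2 := (h k).resolve_left hk'.ne
  refine ⟨j, k, hjk, ?_, ?_, fun i hi => ?_⟩
  · rcases sq_eq_sq_iff_eq_or_eq_neg.1 (hj2.trans hhalf) with h1 | h1 <;> linarith
  · rcases sq_eq_sq_iff_eq_or_eq_neg.1 (hk2.trans hhalf) with h1 | h1 <;> linarith
  · have h1 := Finset.sum_le_univ_sum_of_nonneg (s := {i, j, k}) fun l => sq_nonneg (a l)
    rw [hsq, Finset.sum_insert (by simp [hi]), Finset.sum_pair hjk, hj2, hk2] at h1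
    exact pow_eq_zero_iff two_ne_zero |>.1 (le_antisymm (by linarith) (sq_nonneg _))

lemma IsExpSumDensity.apply_zero_lt {n : ℕ} {a : Fin (n + 1) → ℝ} {p : ℝ → ℝ}
    (hp : IsExpSumDensity a p) (hp0 : ∀ z, 0 ≤ p z) (hsum : ∑ j, a j = 0) {i : Fin (n + 1)}
    (hi : 1 / 2 < a i ^ 2) : p 0 < (√2)⁻¹ := by
  have h1 : |a i| * p 0 ≤ 1 / 2 := by
    rcases lt_trichotomy (a i) 0 with h | h | h
    · rw [abs_of_neg h]
      simpa using hp.neg.mul_apply_zero_le_half (i := i) (fun z => hp0 (-z)) (by simpa using hsum)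
        (neg_pos.2 h)
    · norm_num [h] at hi
    · rw [abs_of_pos h]
      exact hp.mul_apply_zero_le_half hp0 hsum h
  have h2 : (√2)⁻¹ < |a i| := by
    rw [← sq_lt_sq₀ (by positivity) (abs_nonneg _), sq_abs, inv_pow, sq_sqrt zero_le_two]
    linarith
  have hs : (0 : ℝ) < (√2)⁻¹ := by positivity
  have hhalf : (1 / 2 : ℝ) = (√2)⁻¹ * (√2)⁻¹ := by
    rw [← mul_inv, mul_self_sqrt zero_le_two, one_div]
  by_contra! hlt
  nlinarith

/-- **Webb's sharp simplex slicing.**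
For a unit vector `a ∈ ℝ^{n+1}` with `∑ aⱼ = 0`, one has `p_a(0) ≤ 1/√2`, with equality
if and only if `a = (eⱼ - eₖ)/√2` for some `j ≠ k`. -/
theorem webb_simplex_slicing (n : ℕ) (hn : 1 ≤ n)
    (a : EuclideanSpace ℝ (Fin (n + 1))) (hnorm : ‖a‖ = 1)
    (hsum : ∑ j, a j = 0)
    (p : ℝ → ℝ) (hp : IsExpSumDensity (fun j => a j) p) :
    p 0 ≤ (Real.sqrt 2)⁻¹ ∧
      (p 0 = (Real.sqrt 2)⁻¹ ↔
        ∃ j k : Fin (n + 1), j ≠ k ∧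
          a = (Real.sqrt 2)⁻¹ •
            (EuclideanSpace.single j (1 : ℝ) - EuclideanSpace.single k (1 : ℝ))) := by
  set q : ℝ → ℝ := fun z => max (p z) 0
  have hq : IsExpSumDensity (fun j => a j) q := hp.max_zero
  have hq0 (z : ℝ) : 0 ≤ q z := le_max_right _ _
  have hpq : p 0 ≤ q 0 := le_max_left _ _
  have hs : (0 : ℝ) < (√2)⁻¹ := by positivity
  have hsq : ∑ j, a j ^ 2 = 1 := by rw [← EuclideanSpace.real_norm_sq_eq, hnorm, one_pow]
  have hpair (j k : Fin (n + 1)) (hjk : j ≠ k)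
      (ha : a = (√2)⁻¹ • (EuclideanSpace.single j (1 : ℝ) - EuclideanSpace.single k (1 : ℝ))) :
      p 0 = (√2)⁻¹ := by
    have hq1 : q 0 = (√2)⁻¹ := hq.apply_zero_eq_of_two hq0 hjk (by simp [ha, hjk])
      (by simp [ha, hjk.symm]) (fun i hi => by simp [ha, hi.1, hi.2])
    rcases max_choice (p 0) 0 with h | h
    · exact h.symm.trans hq1
    · exact absurd (hq1.symm.trans h) hs.ne'
  suffices h : q 0 ≤ (√2)⁻¹ ∧ (q 0 = (√2)⁻¹ → ∃ j k : Fin (n + 1), j ≠ k ∧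
      a = (√2)⁻¹ • (EuclideanSpace.single j (1 : ℝ) - EuclideanSpace.single k (1 : ℝ))) from
    ⟨hpq.trans h.1, fun hp1 => h.2 (h.1.antisymm (hp1 ▸ hpq)),
      fun ⟨j, k, hjk, ha⟩ => hpair j k hjk ha⟩
  by_cases hbig : ∃ i, 1 / 2 < a i ^ 2
  · obtain ⟨i, hi⟩ := hbig
    have hlt := hq.apply_zero_lt hq0 hsum hi
    exact ⟨hlt.le, fun h => absurd h hlt.ne⟩
  · push Not at hbig
    refine ⟨hq.apply_zero_le hq0 hsq hbig, fun heq => ?_⟩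
    obtain ⟨j, k, hjk, hj, hk, h0⟩ := exists_pair_of_sq_eq_half hsum hsq
      (hq.eq_zero_or_sq_eq_half hq0 hsq hbig heq)
    refine ⟨j, k, hjk, ?_⟩
    ext i
    by_cases hij : i = j
    · subst hij
      simp [hj, hjk]
    by_cases hik : i = k
    · subst hik
      simp [hk, hjk.symm]
    simp [h0 i ⟨hij, hik⟩, hij, hik]
end

section
/- Suppose X and Y are i.i.d. standard exponential random variables and a, b > 0. Then the probability density of aX + bY is uniformly bounded above on ℝ by 1/(e · min{a, b}). -/
open MeasureTheory ProbabilityTheory Real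
open scoped ENNReal

theorem lintegral_comp_const_add_mul (c : ℝ) {b : ℝ} (hb : 0 < b) {g : ℝ → ℝ≥0∞}
    (hg : Measurable g) :
    ∫⁻ y, g (c + b * y) = ENNReal.ofReal b⁻¹ * ∫⁻ u, g u := by
  have hmap := Real.map_volume_mul_left hb.ne'
  rw [abs_of_pos (inv_pos.2 hb)] at hmap
  rw [← lintegral_map (f := fun v => g (c + v)) (by fun_prop) (measurable_const_mul b), hmap,
    lintegral_smul_measure, lintegral_add_left_eq_self g c, smul_eq_mul]

theorem measurable_exponentialPDF (r : ℝ) : Measurable (exponentialPDF r) :=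
  (measurable_exponentialPDFReal r).ennreal_ofReal

theorem exponentialPDF_one_mul_le_indicator {a b : ℝ} (ha : 0 < a) (hab : a ≤ b) (u x : ℝ) :
    exponentialPDF 1 x * exponentialPDF 1 ((u - a * x) / b) ≤
      (Set.Icc 0 (u / a)).indicator (fun _ => ENNReal.ofReal (exp (-(u / b)))) x := by
  have hb : 0 < b := ha.trans_le hab
  rcases lt_or_ge x 0 with hx | hx
  · simp [exponentialPDF_of_neg hx]
  rcases lt_or_ge ((u - a * x) / b) 0 with hy | hy
  · simp [exponentialPDF_of_neg hy]
  have hxu : x ≤ u / a := by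
    rw [le_div_iff₀ ha]
    have := (le_div_iff₀ hb).1 hy
    linarith
  rw [Set.indicator_of_mem (Set.mem_Icc.2 ⟨hx, hxu⟩), exponentialPDF_of_nonneg hx,
    exponentialPDF_of_nonneg hy, ← ENNReal.ofReal_mul (by positivity)]
  apply ENNReal.ofReal_le_ofReal
  simp only [one_mul, ← Real.exp_add]
  apply Real.exp_le_exp.2
  have h : a * x / b ≤ x := by
    rw [div_le_iff₀ hb, mul_comm]
    gcongr
  rw [sub_div]
  linarith

theorem lintegral_exponentialPDF_one_mul_le {a b : ℝ} (ha : 0 < a) (hab : a ≤ b) (u : ℝ) :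
    ENNReal.ofReal b⁻¹ * ∫⁻ x, exponentialPDF 1 x * exponentialPDF 1 ((u - a * x) / b) ≤
      ENNReal.ofReal (1 / (exp 1 * a)) := by
  have hb : 0 < b := ha.trans_le hab
  refine (mul_le_mul_right (lintegral_mono
    (exponentialPDF_one_mul_le_indicator ha hab u)) _).trans ?_
  rw [lintegral_indicator_const measurableSet_Icc, Real.volume_Icc, sub_zero,
    ← ENNReal.ofReal_mul (exp_pos _).le, ← ENNReal.ofReal_mul (inv_pos.2 hb).le]
  apply ENNReal.ofReal_le_ofReal
  calc b⁻¹ * (exp (-(u / b)) * (u / a)) = (u / b * exp (-(u / b))) / a := by field_simp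
    _ ≤ exp (-1) / a := by gcongr; exact mul_exp_neg_le_exp_neg_one _
    _ = 1 / (exp 1 * a) := by rw [exp_neg]; field_simp

theorem map_expMeasure_prod_apply_le {a b : ℝ} (ha : 0 < a) (hab : a ≤ b) {s : Set ℝ}
    (hs : MeasurableSet s) :
    Measure.map (fun z : ℝ × ℝ => a * z.1 + b * z.2) ((expMeasure 1).prod (expMeasure 1)) s ≤
      ENNReal.ofReal (1 / (exp 1 * a)) * volume s := by
  have hb : 0 < b := ha.trans_le hab
  have := isProbabilityMeasure_expMeasure one_pos
  have hq := measurable_exponentialPDF 1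
  have hexp : expMeasure 1 = volume.withDensity (exponentialPDF 1) := rfl
  have h1 : Measurable (s.indicator (1 : ℝ → ℝ≥0∞)) := measurable_one.indicator hs
  have hinner (x : ℝ) : ∫⁻ y, s.indicator 1 (a * x + b * y) ∂expMeasure 1 =
      ENNReal.ofReal b⁻¹ * ∫⁻ u, exponentialPDF 1 ((u - a * x) / b) * s.indicator 1 u := by
    rw [hexp, lintegral_withDensity_eq_lintegral_mul _ hq (by fun_prop),
      ← lintegral_comp_const_add_mul (a * x) hb (by fun_prop)]
    simp [mul_div_cancel_left₀ _ hb.ne']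
  calc _ = ∫⁻ x, ∫⁻ y, s.indicator 1 (a * x + b * y) ∂expMeasure 1 ∂expMeasure 1 := by
        rw [← lintegral_indicator_one hs, lintegral_map h1 (by fun_prop),
          lintegral_prod _ (by fun_prop)]
    _ = ∫⁻ x, ∫⁻ u, ENNReal.ofReal b⁻¹ *
          (exponentialPDF 1 x * exponentialPDF 1 ((u - a * x) / b)) * s.indicator 1 u := by
        simp_rw [hinner]
        rw [hexp, lintegral_withDensity_eq_lintegral_mul _ hq (by fun_prop)]
        refine lintegral_congr fun x => ?_
        rw [Pi.mul_apply, ← mul_assoc, ← lintegral_const_mul _ (by fun_prop)]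
        exact lintegral_congr fun u => by ring
    _ = ∫⁻ u, (ENNReal.ofReal b⁻¹ *
          ∫⁻ x, exponentialPDF 1 x * exponentialPDF 1 ((u - a * x) / b)) * s.indicator 1 u := by
        rw [lintegral_lintegral_swap (by fun_prop)]
        refine lintegral_congr fun u => ?_
        rw [lintegral_mul_const _ (by fun_prop), lintegral_const_mul _ (by fun_prop)]
    _ ≤ ∫⁻ u, ENNReal.ofReal (1 / (exp 1 * a)) * s.indicator 1 u := by
        gcongr with u
        exact lintegral_exponentialPDF_one_mul_le ha hab u
    _ = _ := by rw [lintegral_const_mul _ h1, lintegral_indicator_one hs]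

theorem map_expMeasure_prod_swap (a b : ℝ) :
    Measure.map (fun z : ℝ × ℝ => a * z.1 + b * z.2) ((expMeasure 1).prod (expMeasure 1)) =
      Measure.map (fun z : ℝ × ℝ => b * z.1 + a * z.2)
        ((expMeasure 1).prod (expMeasure 1)) := by
  have := isProbabilityMeasure_expMeasure one_pos
  conv_lhs => rw [← Measure.prod_swap]
  rw [Measure.map_map (by fun_prop) measurable_swap]
  congr 1
  ext z
  simp [add_comm]

theorem le_of_withDensity_le_mul_volume {p : ℝ → ℝ} (hp : Continuous p) {C : ℝ} (hC : 0 ≤ C)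
    (h : ∀ s, MeasurableSet s →
      volume.withDensity (fun x => ENNReal.ofReal (p x)) s ≤ ENNReal.ofReal C * volume s)
    (x : ℝ) : p x ≤ C := by
  have hae : (fun x => ENNReal.ofReal (p x)) ≤ᵐ[volume] fun _ => ENNReal.ofReal C := by
    refine ae_le_of_forall_setLIntegral_le_of_sigmaFinite (by fun_prop) fun s hs _ => ?_
    rw [setLIntegral_const, ← withDensity_apply _ hs]
    exact h s hs
  have hdense := Measure.dense_of_ae hae
  have hclosed : IsClosed {x | p x ≤ C} := isClosed_le hp continuous_const
  have huniv := hclosed.closure_eq ▸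
    (hdense.mono fun y hy => (ENNReal.ofReal_le_ofReal_iff hC).1 hy).closure_eq
  exact Set.eq_univ_iff_forall.1 huniv x

/-- **Lemma (uniform bound on the density of `aX + bY`).**
If `X, Y` are i.i.d. standard exponential random variables and `a, b > 0`, then the
(continuous) probability density `p` of `aX + bY` is uniformly bounded above on `ℝ` by
`1 / (e ⬝ min{a, b})`. -/
theorem density_of_weighted_sum_of_exponentials_le
    (a b : ℝ) (ha : 0 < a) (hb : 0 < b) (p : ℝ → ℝ) (hp : Continuous p)
    (hdens : Measure.map (fun z : ℝ × ℝ => a * z.1 + b * z.2)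
        ((expMeasure 1).prod (expMeasure 1))
      = volume.withDensity (fun x : ℝ => ENNReal.ofReal (p x))) :
    ∀ x : ℝ, p x ≤ 1 / (Real.exp 1 * min a b) := by
  refine le_of_withDensity_le_mul_volume hp (by positivity) fun s hs => ?_
  rw [← hdens]
  rcases le_total a b with hab | hab
  · rw [min_eq_left hab]
    exact map_expMeasure_prod_apply_le ha hab hs
  · rw [min_eq_right hab, map_expMeasure_prod_swap]
    exact map_expMeasure_prod_apply_le hb hab hs
end

section
/- Let a, b, C > 0 and let g_{a,b}(x) = (1/(a+b)) · (e^{−x/a}·1_{x≥0} + e^{x/b}·1_{x<0}). Then for every probability density f on ℝ with ‖f‖_∞ ≤ C, we have ∫_ℝ f · g_{a,b} ≤ C · (1 − exp(−1/(C(a+b)))). -/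
open MeasureTheory Real

/-- Weak duality for the bathtub principle: the integral of `f * g` over all densities `f` bounded
by `C` is controlled through any superlevel set `s` of `g` at level `t`. -/
lemma integral_mul_le_of_superlevel {α : Type*} [MeasurableSpace α] {μ : Measure α}
    {f g : α → ℝ} {C t : ℝ} {s : Set α} (hs : MeasurableSet s)
    (hf : Integrable f μ) (hf0 : 0 ≤ᵐ[μ] f) (hfC : ∀ᵐ x ∂μ, f x ≤ C) (hg0 : ∀ x, 0 ≤ g x)
    (hgs : ∀ x ∈ s, t ≤ g x) (hgsc : ∀ x ∉ s, g x ≤ t)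
    (hint : IntegrableOn (fun x => g x - t) s μ) :
    ∫ x, f x * g x ∂μ ≤ t * ∫ x, f x ∂μ + C * ∫ x in s, (g x - t) ∂μ := by
  have hind : Integrable (s.indicator fun x => g x - t) μ := hint.integrable_indicator hs
  calc ∫ x, f x * g x ∂μ
      ≤ ∫ x, (t * f x + C * s.indicator (fun x => g x - t) x) ∂μ := by
        refine integral_mono_of_nonneg ?_ ((hf.const_mul t).add (hind.const_mul C)) ?_
        · filter_upwards [hf0] with x hx using mul_nonneg hx (hg0 x)
        · filter_upwards [hf0, hfC] with x hx hxC
          have hx' : 0 ≤ f x := hx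
          by_cases hxs : x ∈ s
          · simp only [Set.indicator_of_mem hxs]
            nlinarith [mul_nonneg (sub_nonneg.2 hxC) (sub_nonneg.2 (hgs x hxs))]
          · simp only [Set.indicator_of_notMem hxs]
            nlinarith [mul_nonneg hx' (sub_nonneg.2 (hgsc x hxs))]
    _ = _ := by
        rw [integral_add (hf.const_mul t) (hind.const_mul C), integral_const_mul,
          integral_const_mul, integral_indicator hs]

/-- **Lemma (an optimisation problem for integration against `g_{a,b}`).**
Let `a, b, C > 0` and let `g_{a,b}(x) = (a+b)⁻¹ (e^{-x/a} 1_{x ≥ 0} + e^{x/b} 1_{x < 0})`.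
For every probability density `f` on `ℝ` with `‖f‖_∞ ≤ C`, we have
`∫ f ⬝ g_{a,b} ≤ C (1 - exp(-1/(C(a+b))))`. -/
theorem integral_against_g_le (a b C : ℝ) (ha : 0 < a) (hb : 0 < b) (hC : 0 < C)
    (g : ℝ → ℝ)
    (hg : ∀ x : ℝ, g x = (a + b)⁻¹ * (if 0 ≤ x then Real.exp (-x / a) else Real.exp (x / b)))
    (f : ℝ → ℝ) (hmeas : Measurable f) (hnonneg : ∀ x, 0 ≤ f x)
    (hint : ∫ x : ℝ, f x = 1) (hbdd : ∀ᵐ x : ℝ, f x ≤ C) :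
    ∫ x : ℝ, f x * g x ≤ C * (1 - Real.exp (-(1 / (C * (a + b))))) := by
  have hab : 0 < a + b := add_pos ha hb
  have hf : Integrable f := by
    by_contra h
    simp [integral_undef h] at hint
  obtain ⟨s, hs⟩ : ∃ s, s = 1 / (C * (a + b)) := ⟨_, rfl⟩
  have hs0 : 0 < s := by rw [hs]; positivity
  rw [← hs]
  have hleft : -(b * s) ≤ 0 := by nlinarith
  have hright : 0 ≤ a * s := by positivity
  have hg_nonneg (x : ℝ) (hx : 0 ≤ x) : g x = (a + b)⁻¹ * exp (x / -a) := by
    rw [hg, if_pos hx, div_neg, neg_div]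
  have hg_nonpos (x : ℝ) (hx : x ≤ 0) : g x = (a + b)⁻¹ * exp (x / b) := by
    rcases hx.lt_or_eq with h | rfl
    · rw [hg, if_neg h.not_ge]
    · simp [hg]
  have hcong_left : Set.EqOn (fun x => (a + b)⁻¹ * exp (x / b)) g (Set.uIcc (-(b * s)) 0) := by
    intro x hx
    rw [Set.uIcc_of_le hleft] at hx
    exact (hg_nonpos x hx.2).symm
  have hcong_right : Set.EqOn (fun x => (a + b)⁻¹ * exp (x / -a)) g (Set.uIcc 0 (a * s)) := by
    intro x hx
    rw [Set.uIcc_of_le hright] at hx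
    exact (hg_nonneg x hx.1).symm
  have hint_left : IntervalIntegrable g volume (-(b * s)) 0 :=
    ((by fun_prop : Continuous fun x => (a + b)⁻¹ * exp (x / b)).intervalIntegrable _ _).congr
      (hcong_left.mono Set.uIoc_subset_uIcc)
  have hint_right : IntervalIntegrable g volume 0 (a * s) :=
    ((by fun_prop : Continuous fun x => (a + b)⁻¹ * exp (x / -a)).intervalIntegrable _ _).congr
      (hcong_right.mono Set.uIoc_subset_uIcc)
  have hg_int := hint_left.trans hint_right
  have hval_left : ∫ x in -(b * s)..0, g x = (a + b)⁻¹ * (b * (1 - exp (-s))) := by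
    rw [← intervalIntegral.integral_congr hcong_left, intervalIntegral.integral_const_mul,
      intervalIntegral.integral_comp_div _ hb.ne', integral_exp, smul_eq_mul, zero_div, exp_zero,
      neg_div, mul_div_cancel_left₀ _ hb.ne']
  have hval_right : ∫ x in 0..a * s, g x = (a + b)⁻¹ * (a * (1 - exp (-s))) := by
    rw [← intervalIntegral.integral_congr hcong_right, intervalIntegral.integral_const_mul,
      intervalIntegral.integral_comp_div _ (neg_ne_zero.2 ha.ne'), integral_exp, smul_eq_mul,
      zero_div, exp_zero, div_neg, mul_div_cancel_left₀ _ ha.ne']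
    ring
  have hval : ∫ x in -(b * s)..a * s, (g x - (a + b)⁻¹ * exp (-s)) =
      (1 - exp (-s)) - s * exp (-s) := by
    rw [intervalIntegral.integral_sub hg_int intervalIntegrable_const,
      ← intervalIntegral.integral_add_adjacent_intervals hint_left hint_right, hval_left,
      hval_right, intervalIntegral.integral_const, smul_eq_mul]
    field_simp
    ring
  have key := integral_mul_le_of_superlevel (g := g) (t := (a + b)⁻¹ * exp (-s))
    (measurableSet_Ioc (a := -(b * s)) (b := a * s)) hf (.of_forall hnonneg) hbdd
    (fun x => by rw [hg]; split_ifs <;> positivity) ?_ ?_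
    ((intervalIntegrable_iff_integrableOn_Ioc_of_le (hleft.trans hright)).1
      (hg_int.sub intervalIntegrable_const))
  · rw [← intervalIntegral.integral_of_le (hleft.trans hright), hval, hint] at key
    refine key.trans_eq ?_
    rw [mul_one, hs]
    field_simp
    ring
  · rintro x ⟨hx1, hx2⟩
    rcases le_total 0 x with h | h
    · rw [hg_nonneg x h, div_neg]
      gcongr
      exact (div_le_iff₀' ha).2 hx2
    · rw [hg_nonpos x h]
      gcongr
      rw [le_div_iff₀' hb]
      linarith
  · intro x hx
    rw [Set.mem_Ioc, not_and_or, not_lt, not_le] at hx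
    rcases hx with h | h
    · rw [hg_nonpos x (h.trans hleft)]
      gcongr
      rw [div_le_iff₀' hb]
      linarith
    · rw [hg_nonneg x (hright.trans h.le), div_neg]
      gcongr
      exact (le_div_iff₀' ha).2 h.le
end

section
/- For every log-concave probability density f on ℝ, we have ‖f‖_∞ ≤ (∫ x² f(x) dx − (∫ x f(x) dx)²)^{−1/2}; that is, the supremum of f is at most the reciprocal of the standard deviation of the distribution with density f. -/
open MeasureTheory Real

/-- A nonnegative function is log-concave (i.e. of the form `e^{-V}` with
`V : ℝ → (-∞, +∞]` convex) iff it satisfies the multiplicative concavity inequality. -/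
def LogConcaveFun {E : Type*} [AddCommGroup E] [Module ℝ E] (f : E → ℝ) : Prop :=
  ∀ x y : E, ∀ t : ℝ, 0 ≤ t → t ≤ 1 →
    f x ^ t * f y ^ (1 - t) ≤ f (t • x + (1 - t) • y)

open Set

lemma LogConcaveFun.ordConnected_exp_le {f : ℝ → ℝ} (hlc : LogConcaveFun f) {α : ℝ} (hα : 0 < α)
    (β : ℝ) : OrdConnected {x | α * exp (-(β * x)) ≤ f x} := by
  refine Convex.ordConnected (convex_iff_forall_pos.2 ?_)
  intro x hx y hy s t hs ht hst
  obtain rfl : t = 1 - s := by linarith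
  simp only [mem_ofPred_eq] at hx hy ⊢
  refine le_trans ?_ (hlc x y s hs.le (by linarith))
  have key : α * exp (-(β * (s • x + (1 - s) • y)))
      = (α * exp (-(β * x))) ^ s * (α * exp (-(β * y))) ^ (1 - s) := by
    rw [mul_rpow hα.le (exp_pos _).le, mul_rpow hα.le (exp_pos _).le, ← exp_mul, ← exp_mul,
      mul_mul_mul_comm, ← rpow_add hα, ← exp_add, add_sub_cancel, rpow_one]
    simp only [smul_eq_mul]
    ring_nf
  rw [key]
  have h1 : 0 < α * exp (-(β * x)) := by positivity
  have h2 : 0 < α * exp (-(β * y)) := by positivity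
  have := h1.trans_le hx
  gcongr

lemma LogConcaveFun.comp_neg {f : ℝ → ℝ} (hlc : LogConcaveFun f) :
    LogConcaveFun fun x => f (-x) := by
  intro x y t h0 h1
  have := hlc (-x) (-y) t h0 h1
  rwa [smul_neg, smul_neg, ← neg_add] at this

lemma LogConcaveFun.comp_add_left {f : ℝ → ℝ} (hlc : LogConcaveFun f) (a : ℝ) :
    LogConcaveFun fun x => f (a + x) := by
  intro x y t h0 h1
  have := hlc (a + x) (a + y) t h0 h1
  convert this using 2
  simp only [smul_eq_mul]
  ring

lemma integral_pow_mul_exp_neg_mul_Ioi (n : ℕ) {β : ℝ} (hβ : 0 < β) :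
    ∫ x in Ioi (0 : ℝ), x ^ n * exp (-(β * x)) = n.factorial / β ^ (n + 1) := by
  have h := Real.integral_rpow_mul_exp_neg_mul_Ioi (a := n + 1) (r := β) (by positivity) hβ
  rw [Real.Gamma_nat_eq_factorial] at h
  simp only [add_sub_cancel_right, rpow_natCast] at h
  rw [h, show ((n : ℝ) + 1) = ((n + 1 : ℕ) : ℝ) by push_cast; ring, rpow_natCast,
    one_div, inv_pow]
  ring

lemma integrableOn_pow_mul_exp_neg_mul_Ioi (n : ℕ) {β : ℝ} (hβ : 0 < β) :
    IntegrableOn (fun x : ℝ => x ^ n * exp (-(β * x))) (Ioi 0) := by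
  by_contra h
  have h1 := integral_pow_mul_exp_neg_mul_Ioi n hβ
  rw [integral_undef h] at h1
  have : (0 : ℝ) < n.factorial / β ^ (n + 1) := by positivity
  linarith

lemma LogConcaveFun.exists_exp_decay {f : ℝ → ℝ} (hlc : LogConcaveFun f)
    (hm : 0 < f 0) (hf : IntegrableOn f (Ioi 0)) :
    ∃ β > 0, ∃ c > 0, ∀ x ≥ c, f x ≤ f 0 * exp (-(β * x)) := by
  obtain ⟨c, hc, hfc⟩ : ∃ c > 0, f c < f 0 := by
    by_contra! h
    have : IntegrableOn (fun _ : ℝ => f 0) (Ioi (0 : ℝ)) := by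
      refine Integrable.mono' hf aestronglyMeasurable_const ?_
      filter_upwards [ae_restrict_mem measurableSet_Ioi] with x hx
      rw [norm_of_nonneg hm.le]
      exact h x hx
    rw [integrableOn_const_iff] at this
    simp [hm.ne'] at this
  obtain ⟨β, hβ, hβc⟩ : ∃ β > 0, f c < f 0 * exp (-(β * c)) := by
    have ht : Filter.Tendsto (fun β : ℝ => f 0 * exp (-(β * c))) (nhdsWithin 0 (Ioi 0))
        (nhds (f 0 * exp (-(0 * c)))) :=
      (Continuous.tendsto (by fun_prop) 0).mono_left nhdsWithin_le_nhds
    have h1 := ht.eventually (lt_mem_nhds (a := f c) (by simpa using hfc))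
    obtain ⟨β, h2, h3⟩ := (h1.and self_mem_nhdsWithin).exists
    exact ⟨β, h3, h2⟩
  refine ⟨β, hβ, c, hc, fun x hx => ?_⟩
  by_contra! h
  have := (hlc.ordConnected_exp_le hm β).out (x := 0) (y := x) (by simp) h.le ⟨hc.le, hx⟩
  exact absurd this (not_le.2 hβc)

lemma LogConcaveFun.integrableOn_pow_mul {f : ℝ → ℝ} (hlc : LogConcaveFun f)
    (hnn : ∀ x, 0 ≤ f x) (hm : 0 < f 0) (hf : IntegrableOn f (Ioi 0)) (n : ℕ) :
    IntegrableOn (fun x => x ^ n * f x) (Ioi 0) := by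
  obtain ⟨β, hβ, c, hc, h⟩ := hlc.exists_exp_decay hm hf
  refine Integrable.mono' ((hf.const_mul (c ^ n)).add
    ((integrableOn_pow_mul_exp_neg_mul_Ioi n hβ).const_mul (f 0)))
    ((by fun_prop : Continuous fun x : ℝ => x ^ n).aestronglyMeasurable.mul
      hf.aestronglyMeasurable) ?_
  filter_upwards [ae_restrict_mem measurableSet_Ioi] with x hx
  have hx0 : 0 < x := hx
  have hfx := hnn x
  rw [norm_of_nonneg (by positivity)]
  simp only [Pi.add_apply]
  rcases le_total x c with hxc | hxc
  · have h1 : x ^ n * f x ≤ c ^ n * f x := by gcongr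
    have h2 : 0 ≤ f 0 * (x ^ n * exp (-(β * x))) := by positivity
    linarith
  · have h1 : x ^ n * f x ≤ x ^ n * (f 0 * exp (-(β * x))) := by gcongr; exact h x hxc
    have h2 : 0 ≤ c ^ n * f x := by positivity
    linarith

/-- Comparison with the exponential of the same value at `0` and the same mass. -/
lemma LogConcaveFun.mul_integral_Ioi_le {f : ℝ → ℝ} (hlc : LogConcaveFun f)
    (hnn : ∀ x, 0 ≤ f x) (hm : 0 < f 0) (hf : IntegrableOn f (Ioi 0)) :
    f 0 * ∫ x in Ioi 0, x * f x ≤ (∫ x in Ioi 0, f x) ^ 2 := by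
  have hf1 : IntegrableOn (fun x => x * f x) (Ioi 0) := by
    simpa using hlc.integrableOn_pow_mul hnn hm hf 1
  rcases (integral_nonneg hnn : 0 ≤ ∫ x in Ioi 0, f x).eq_or_lt with hp | hp
  · have h0 := (integral_eq_zero_iff_of_nonneg hnn hf).1 hp.symm
    have : ∫ x in Ioi 0, x * f x = 0 := by
      refine integral_eq_zero_of_ae ?_
      filter_upwards [h0] with x hx
      simp [hx]
    rw [this, ← hp]
    simp
  set p := ∫ x in Ioi 0, f x with hp_def
  have hβ : 0 < f 0 / p := by positivity
  set β := f 0 / p with hβ_def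
  have hg0 : IntegrableOn (fun x => f 0 * exp (-(β * x))) (Ioi 0) := by
    simpa [IntegrableOn] using (integrableOn_pow_mul_exp_neg_mul_Ioi 0 hβ).const_mul (f 0)
  have hg1 : IntegrableOn (fun x => x * (f 0 * exp (-(β * x)))) (Ioi 0) := by
    simpa [IntegrableOn, mul_left_comm] using
      (integrableOn_pow_mul_exp_neg_mul_Ioi 1 hβ).const_mul (f 0)
  have ig0 : ∫ x in Ioi 0, f 0 * exp (-(β * x)) = p := by
    have := integral_pow_mul_exp_neg_mul_Ioi 0 hβ
    simp only [pow_zero, one_mul, Nat.factorial_zero, Nat.cast_one, zero_add, pow_one] at this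
    rw [integral_const_mul, this, hβ_def]
    field_simp
  have ig1 : ∫ x in Ioi 0, x * (f 0 * exp (-(β * x))) = p ^ 2 / f 0 := by
    have := integral_pow_mul_exp_neg_mul_Ioi 1 hβ
    simp only [pow_one, Nat.factorial_one, Nat.cast_one] at this
    simp_rw [mul_left_comm _ (f 0)]
    rw [integral_const_mul, this, hβ_def, div_pow]
    field_simp
  have hh0 := hf.sub hg0
  have hh1 := hf1.sub hg1
  set h : ℝ → ℝ := fun x => f x - f 0 * exp (-(β * x)) with h_def
  have ih0 : ∫ x in Ioi 0, h x = 0 := by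
    rw [h_def, integral_sub hf hg0, ig0, sub_self]
  have hh0 : IntegrableOn h (Ioi 0) := hh0
  have hxh : IntegrableOn (fun x => x * h x) (Ioi 0) := by
    refine hh1.congr (Filter.Eventually.of_forall fun x => ?_)
    simp [h_def, mul_sub]
  have ih1 : ∫ x in Ioi 0, x * h x = (∫ x in Ioi 0, x * f x) - p ^ 2 / f 0 := by
    rw [← ig1, ← integral_sub hf1 hg1]
    simp [h_def, mul_sub]
  suffices hle : ∫ x in Ioi 0, x * h x ≤ 0 by
    rw [ih1, sub_nonpos, le_div_iff₀ hm] at hle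
    linarith
  have hI := hlc.ordConnected_exp_le hm β
  set I := {x | f 0 * exp (-(β * x)) ≤ f x} with I_def
  have h0I : (0 : ℝ) ∈ I := by simp [I_def]
  by_cases hb : BddAbove I
  · have : ∫ x in Ioi 0, (x - sSup I) * h x = ∫ x in Ioi 0, x * h x := by
      simp_rw [sub_mul]
      rw [integral_sub hxh (hh0.const_mul _), integral_const_mul, ih0, mul_zero, sub_zero]
    rw [← this]
    refine setIntegral_nonpos measurableSet_Ioi fun x hx => ?_
    rcases lt_or_ge x (sSup I) with hxb | hxb
    · obtain ⟨y, hy, hxy⟩ := exists_lt_of_lt_csSup ⟨0, h0I⟩ hxb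
      have : x ∈ I := hI.out h0I hy ⟨(mem_Ioi.1 hx).le, hxy.le⟩
      exact mul_nonpos_of_nonpos_of_nonneg (by linarith) (sub_nonneg.2 this)
    · rcases hxb.eq_or_lt with hxb | hxb
      · simp [hxb]
      · have : x ∉ I := notMem_of_csSup_lt hxb hb
        exact mul_nonpos_of_nonneg_of_nonpos (by linarith) (sub_nonpos.2 (not_le.1 this).le)
  · have hall : ∀ x ∈ Ioi (0 : ℝ), 0 ≤ h x := by
      intro x hx
      obtain ⟨y, hy, hxy⟩ := not_bddAbove_iff.1 hb x
      exact sub_nonneg.2 (hI.out h0I hy ⟨(mem_Ioi.1 hx).le, hxy.le⟩)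
    have hz := (setIntegral_eq_zero_iff_of_nonneg_ae
      ((ae_restrict_iff' measurableSet_Ioi).2 (Filter.Eventually.of_forall hall)) hh0).1 ih0
    refine (integral_eq_zero_of_ae ?_).le
    filter_upwards [hz] with x hx
    simp [hx]

lemma integral_quadratic_mul {ν : Measure ℝ} {h : ℝ → ℝ} (h0 : Integrable h ν)
    (h1 : Integrable (fun x => x * h x) ν) (h2 : Integrable (fun x => x ^ 2 * h x) ν) (b c : ℝ) :
    Integrable (fun x => (x ^ 2 + b * x + c) * h x) ν ∧
      ∫ x, (x ^ 2 + b * x + c) * h x ∂ν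
        = (∫ x, x ^ 2 * h x ∂ν) + b * (∫ x, x * h x ∂ν) + c * ∫ x, h x ∂ν := by
  have e : ∀ x, (x ^ 2 + b * x + c) * h x = x ^ 2 * h x + (b * (x * h x) + c * h x) :=
    fun x => by ring
  have h10 : Integrable (fun x => b * (x * h x) + c * h x) ν := (h1.const_mul b).add (h0.const_mul c)
  simp_rw [e]
  refine ⟨h2.add h10, ?_⟩
  rw [integral_add h2 h10, integral_add (h1.const_mul b) (h0.const_mul c), integral_const_mul,
    integral_const_mul, add_assoc]

/-- If `{h ≥ 0}` is an interval on the positive half-line and `h` is orthogonal to affine functions,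
then the second moment of `h` is nonpositive. -/
lemma integral_sq_mul_nonpos_of_ordConnected {h : ℝ → ℝ} (hI : OrdConnected {x | 0 ≤ h x})
    (h0 : IntegrableOn h (Ioi 0)) (h1 : IntegrableOn (fun x => x * h x) (Ioi 0))
    (h2 : IntegrableOn (fun x => x ^ 2 * h x) (Ioi 0))
    (i0 : ∫ x in Ioi 0, h x = 0) (i1 : ∫ x in Ioi 0, x * h x = 0) :
    ∫ x in Ioi 0, x ^ 2 * h x ≤ 0 := by
  have hI' : OrdConnected ({x | 0 ≤ h x} ∩ Ioi 0) := hI.inter ordConnected_Ioi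
  set I := {x | 0 ≤ h x} ∩ Ioi 0 with I_def
  have hbelow : BddBelow I := ⟨0, fun x hx => (mem_Ioi.1 hx.2).le⟩
  rcases I.eq_empty_or_nonempty with hem | hne
  · have hneg : ∀ x ∈ Ioi (0 : ℝ), h x ≤ 0 := by
      intro x hx
      by_contra! hc
      exact (Set.eq_empty_iff_forall_notMem.1 hem) x ⟨hc.le, hx⟩
    exact setIntegral_nonpos measurableSet_Ioi fun x hx =>
      mul_nonpos_of_nonneg_of_nonpos (sq_nonneg x) (hneg x hx)
  have hlow : ∀ x ∈ Ioi (0 : ℝ), x < sInf I → h x ≤ 0 := by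
    intro x hx hxa
    by_contra! hc
    exact notMem_of_lt_csInf hxa hbelow ⟨hc.le, hx⟩
  by_cases hb : BddAbove I
  · have : ∫ x in Ioi 0, ((x - sInf I) * (x - sSup I)) * h x = ∫ x in Ioi 0, x ^ 2 * h x := by
      have e := (integral_quadratic_mul h0 h1 h2 (-(sInf I + sSup I)) (sInf I * sSup I)).2
      rw [i0, i1, mul_zero, mul_zero, add_zero, add_zero] at e
      rw [← e]
      congr 1 with x
      ring
    rw [← this]
    refine setIntegral_nonpos measurableSet_Ioi fun x hx => ?_
    have hab : sInf I ≤ sSup I := csInf_le_csSup hne hbelow hb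
    rcases lt_trichotomy x (sInf I) with hxa | hxa | hxa
    · exact mul_nonpos_of_nonneg_of_nonpos
        (mul_nonneg_of_nonpos_of_nonpos (by linarith) (by linarith)) (hlow x hx hxa)
    · simp [hxa]
    · rcases lt_trichotomy x (sSup I) with hxb | hxb | hxb
      · obtain ⟨y, hy, hyx⟩ := exists_lt_of_csInf_lt hne hxa
        obtain ⟨z, hz, hxz⟩ := exists_lt_of_lt_csSup hne hxb
        have : x ∈ I := hI'.out hy hz ⟨hyx.le, hxz.le⟩
        exact mul_nonpos_of_nonpos_of_nonneg
          (mul_nonpos_of_nonneg_of_nonpos (by linarith) (by linarith)) this.1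
      · simp [hxb]
      · have : h x ≤ 0 := by
          by_contra! hc
          exact notMem_of_csSup_lt hxb hb ⟨hc.le, hx⟩
        exact mul_nonpos_of_nonneg_of_nonpos
          (mul_nonneg (by linarith) (by linarith)) this
  · have hall : ∀ x ∈ Ioi (0 : ℝ), 0 ≤ (x - sInf I) * h x := by
      intro x hx
      rcases lt_trichotomy x (sInf I) with hxa | hxa | hxa
      · exact mul_nonneg_of_nonpos_of_nonpos (by linarith) (hlow x hx hxa)
      · simp [hxa]
      · obtain ⟨y, hy, hyx⟩ := exists_lt_of_csInf_lt hne hxa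
        obtain ⟨z, hz, hxz⟩ := not_bddAbove_iff.1 hb x
        have : x ∈ I := hI'.out hy hz ⟨hyx.le, hxz.le⟩
        exact mul_nonneg (by linarith) this.1
    have hint : IntegrableOn (fun x => (x - sInf I) * h x) (Ioi 0) := by
      simp_rw [sub_mul]
      exact h1.sub (h0.const_mul _)
    have iz : ∫ x in Ioi 0, (x - sInf I) * h x = 0 := by
      simp_rw [sub_mul]
      rw [integral_sub h1 (h0.const_mul _), integral_const_mul, i0, i1]
      ring
    have hz := (setIntegral_eq_zero_iff_of_nonneg_ae
      ((ae_restrict_iff' measurableSet_Ioi).2 (Filter.Eventually.of_forall hall)) hint).1 iz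
    refine (integral_eq_zero_of_ae ?_).le
    filter_upwards [hz, ae_restrict_of_ae (Measure.ae_ne volume (sInf I))] with x hx hxa
    rcases mul_eq_zero.1 hx with h' | h'
    · exact absurd (sub_eq_zero.1 h') hxa
    · simp [h']

/-- Comparison with the exponential of the same mass and the same first moment. -/
lemma LogConcaveFun.integral_sq_mul_Ioi_le {f : ℝ → ℝ} (hlc : LogConcaveFun f)
    (hnn : ∀ x, 0 ≤ f x) (hm : 0 < f 0) (hf : IntegrableOn f (Ioi 0)) :
    ∫ x in Ioi 0, x ^ 2 * f x ≤ 2 * (∫ x in Ioi 0, x * f x) ^ 2 / ∫ x in Ioi 0, f x := by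
  have hf1 : IntegrableOn (fun x => x * f x) (Ioi 0) := by
    simpa using hlc.integrableOn_pow_mul hnn hm hf 1
  have hf2 := hlc.integrableOn_pow_mul hnn hm hf 2
  have hA0 : ∀ x ∈ Ioi (0 : ℝ), 0 ≤ x * f x := fun x hx =>
    mul_nonneg (mem_Ioi.1 hx).le (hnn x)
  rcases (setIntegral_nonneg measurableSet_Ioi hA0).eq_or_lt with hA | hA
  · have h0 := (setIntegral_eq_zero_iff_of_nonneg_ae
      ((ae_restrict_iff' measurableSet_Ioi).2 (Filter.Eventually.of_forall hA0)) hf1).1 hA.symm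
    have : ∫ x in Ioi 0, x ^ 2 * f x = 0 := by
      refine integral_eq_zero_of_ae ?_
      filter_upwards [h0] with x hx
      simp only [Pi.zero_apply] at hx ⊢
      rw [sq, mul_assoc, hx, mul_zero]
    rw [this, ← hA]
    simp
  have hp : 0 < ∫ x in Ioi 0, f x := by
    have := hlc.mul_integral_Ioi_le hnn hm hf
    have h2 : 0 < (∫ x in Ioi 0, f x) ^ 2 := (mul_pos hm hA).trans_le this
    exact lt_of_le_of_ne (integral_nonneg hnn) (fun h => by simp [← h] at h2)
  set p := ∫ x in Ioi 0, f x with hp_def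
  set A := ∫ x in Ioi 0, x * f x with hA_def
  have hβ : 0 < p / A := by positivity
  set β := p / A with hβ_def
  have hα : 0 < p ^ 2 / A := by positivity
  set α := p ^ 2 / A with hα_def
  have hg : ∀ n : ℕ, IntegrableOn (fun x => x ^ n * (α * exp (-(β * x)))) (Ioi 0) := fun n => by
    simpa [IntegrableOn, mul_left_comm] using
      (integrableOn_pow_mul_exp_neg_mul_Ioi n hβ).const_mul α
  have ig : ∀ n : ℕ, ∫ x in Ioi 0, x ^ n * (α * exp (-(β * x)))
      = α * (n.factorial / β ^ (n + 1)) := fun n => by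
    simp_rw [mul_left_comm _ α]
    rw [integral_const_mul, integral_pow_mul_exp_neg_mul_Ioi n hβ]
  have hhn : ∀ n : ℕ, IntegrableOn (fun x => x ^ n * (f x - α * exp (-(β * x)))) (Ioi 0) :=
    fun n => by
      simp_rw [mul_sub]
      exact (hlc.integrableOn_pow_mul hnn hm hf n).sub (hg n)
  have ih : ∀ n : ℕ, ∫ x in Ioi 0, x ^ n * (f x - α * exp (-(β * x)))
      = (∫ x in Ioi 0, x ^ n * f x) - α * (n.factorial / β ^ (n + 1)) := fun n => by
    simp_rw [mul_sub]
    rw [integral_sub (hlc.integrableOn_pow_mul hnn hm hf n) (hg n), ig]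
  have key := integral_sq_mul_nonpos_of_ordConnected
    (h := fun x => f x - α * exp (-(β * x)))
    (by simpa only [sub_nonneg] using hlc.ordConnected_exp_le hα β)
    (by simpa using hhn 0) (by simpa using hhn 1) (hhn 2)
    (by
      have := ih 0
      simp only [pow_zero, one_mul, Nat.factorial_zero, Nat.cast_one, zero_add, pow_one] at this
      rw [this, ← hp_def, hα_def, hβ_def]
      field_simp
      ring)
    (by
      have := ih 1
      simp only [pow_one, Nat.factorial_one, Nat.cast_one] at this
      rw [this, ← hA_def, hα_def, hβ_def, div_pow]
      field_simp
      ring)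
  rw [ih 2] at key
  have e : α * ((2 : ℕ).factorial / β ^ (2 + 1)) = 2 * A ^ 2 / p := by
    rw [hα_def, hβ_def, div_pow, Nat.factorial_two]
    field_simp
    push_cast
    ring
  linarith

lemma moment_bound {m p q A B C D : ℝ} (hm : 0 < m) (hp : 0 ≤ p) (hq : 0 ≤ q) (hpq : p + q = 1)
    (hA : 0 ≤ A) (hB : 0 ≤ B) (hAp : m * A ≤ p ^ 2) (hBq : m * B ≤ q ^ 2)
    (hC : C ≤ 2 * A ^ 2 / p) (hD : D ≤ 2 * B ^ 2 / q) :
    m ^ 2 * (C + D - (A - B) ^ 2) ≤ 1 := by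
  have aux : ∀ {r E F : ℝ}, 0 ≤ r → 0 ≤ E → m * E ≤ r ^ 2 → F ≤ 2 * E ^ 2 / r →
      ∃ u, 0 ≤ u ∧ u ≤ r ∧ m * E = u * r ∧ m ^ 2 * F ≤ 2 * u ^ 2 * r := by
    intro r E F hr hE hEr hF
    rcases hr.eq_or_lt with rfl | hr
    · have : m * E = 0 := le_antisymm (by simpa using hEr) (by positivity)
      refine ⟨0, le_rfl, le_rfl, by simpa using this, ?_⟩
      rw [div_zero] at hF
      have := mul_nonpos_of_nonneg_of_nonpos (sq_nonneg m) hF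
      simpa using this
    · refine ⟨m * E / r, by positivity, ?_, by field_simp, ?_⟩
      · rw [div_le_iff₀ hr]; nlinarith
      · calc m ^ 2 * F ≤ m ^ 2 * (2 * E ^ 2 / r) := by gcongr
          _ = _ := by field_simp
  obtain ⟨u, hu0, hup, hAu, hCu⟩ := aux hp hA hAp hC
  obtain ⟨v, hv0, hvq, hBv, hDv⟩ := aux hq hB hBq hD
  have e : m ^ 2 * (C + D - (A - B) ^ 2) = m ^ 2 * C + m ^ 2 * D - (m * A - m * B) ^ 2 := by ring
  rw [e, hAu, hBv]
  have hp2 : 0 ≤ 2 - p := by linarith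
  have hq2 : 0 ≤ 2 - q := by linarith
  have i1 : u ^ 2 * (p * (2 - p)) ≤ p ^ 2 * (p * (2 - p)) := by gcongr
  have i2 : v ^ 2 * (q * (2 - q)) ≤ q ^ 2 * (q * (2 - q)) := by gcongr
  have i3 : (u * v) * (2 * p * q) ≤ (p * q) * (2 * p * q) := by gcongr
  have i4 : p ^ 2 * (p * (2 - p)) + q ^ 2 * (q * (2 - q)) + (p * q) * (2 * p * q)
      = 1 - 2 * (p * q) := by
    obtain rfl : q = 1 - p := by linarith
    ring
  nlinarith [mul_nonneg hp hq]

lemma integral_eq_integral_Ioi_add_comp_neg {g : ℝ → ℝ} (hg : IntegrableOn g (Ioi 0))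
    (hg' : IntegrableOn (fun x => g (-x)) (Ioi 0)) :
    Integrable g ∧ ∫ x, g x = (∫ x in Ioi 0, g x) + ∫ x in Ioi 0, g (-x) := by
  have hI : IntegrableOn g (Iic 0) := by
    rw [integrableOn_Iic_iff_integrableOn_Iio,
      ← (Measure.measurePreserving_neg volume).integrableOn_comp_preimage
        (MeasurableEquiv.neg ℝ).measurableEmbedding]
    simpa [Function.comp_def] using hg'
  refine ⟨?_, ?_⟩
  · rw [← integrableOn_univ, ← Iic_union_Ioi (a := (0 : ℝ))]
    exact hI.union hg
  · rw [← intervalIntegral.integral_Iic_add_Ioi hI hg, integral_comp_neg_Ioi, neg_zero, add_comm]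

lemma LogConcaveFun.sq_mul_variance_le_of_zero {f : ℝ → ℝ} (hlc : LogConcaveFun f)
    (hnn : ∀ x, 0 ≤ f x) (hf : Integrable f) (hint : ∫ x, f x = 1) (hm : 0 < f 0) :
    Integrable (fun x => x * f x) ∧ Integrable (fun x => x ^ 2 * f x) ∧
      f 0 ^ 2 * ((∫ x, x ^ 2 * f x) - (∫ x, x * f x) ^ 2) ≤ 1 := by
  have hm' : 0 < (fun x => f (-x)) 0 := by simpa using hm
  have hnn' : ∀ x, 0 ≤ (fun x => f (-x)) x := fun x => hnn _
  have hr := hf.integrableOn (s := Ioi 0)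
  have hl : IntegrableOn (fun x => f (-x)) (Ioi 0) := hf.comp_neg.integrableOn
  have r1 : IntegrableOn (fun x => x * f x) (Ioi 0) := by
    simpa using hlc.integrableOn_pow_mul hnn hm hr 1
  have r2 := hlc.integrableOn_pow_mul hnn hm hr 2
  have l1 : IntegrableOn (fun x => x * f (-x)) (Ioi 0) := by
    simpa using hlc.comp_neg.integrableOn_pow_mul hnn' hm' hl 1
  have l2 := hlc.comp_neg.integrableOn_pow_mul hnn' hm' hl 2
  obtain ⟨-, e0⟩ := integral_eq_integral_Ioi_add_comp_neg hr hl
  obtain ⟨j1, e1⟩ := integral_eq_integral_Ioi_add_comp_neg (g := fun x => x * f x) r1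
    (l1.neg.congr (Filter.Eventually.of_forall fun x => by simp))
  obtain ⟨j2, e2⟩ := integral_eq_integral_Ioi_add_comp_neg (g := fun x => x ^ 2 * f x) r2
    (by simpa only [neg_sq] using l2)
  refine ⟨j1, j2, ?_⟩
  simp only [neg_mul, integral_neg, ← sub_eq_add_neg] at e1
  simp only [neg_sq] at e2
  rw [e1, e2]
  refine moment_bound hm (integral_nonneg hnn) (integral_nonneg hnn') (e0.symm.trans hint)
    (setIntegral_nonneg measurableSet_Ioi fun x hx => mul_nonneg (mem_Ioi.1 hx).le (hnn x))
    (setIntegral_nonneg measurableSet_Ioi fun x hx => mul_nonneg (mem_Ioi.1 hx).le (hnn' x))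
    (hlc.mul_integral_Ioi_le hnn hm hr) ?_ (hlc.integral_sq_mul_Ioi_le hnn hm hr)
    (hlc.comp_neg.integral_sq_mul_Ioi_le hnn' hm' hl)
  simpa using hlc.comp_neg.mul_integral_Ioi_le hnn' hm' hl

lemma variance_density_comp_add_left {f : ℝ → ℝ} (hf : Integrable f) (hint : ∫ x, f x = 1) (a : ℝ)
    (h1 : Integrable (fun x => x * f (a + x))) (h2 : Integrable (fun x => x ^ 2 * f (a + x))) :
    (∫ x, x ^ 2 * f x) - (∫ x, x * f x) ^ 2
      = (∫ x, x ^ 2 * f (a + x)) - (∫ x, x * f (a + x)) ^ 2 := by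
  have h0 : Integrable (fun x => f (a + x)) := hf.comp_add_left a
  have i0 : ∫ x, f (a + x) = 1 := by rw [integral_add_left_eq_self f a, hint]
  have e1 : ∫ x, x * f x = (∫ x, x * f (a + x)) + a := by
    rw [← integral_add_left_eq_self (fun x => x * f x) a]
    simp_rw [add_mul]
    rw [integral_add (h0.const_mul a) h1, integral_const_mul, i0]
    ring
  have e2 : ∫ x, x ^ 2 * f x
      = (∫ x, x ^ 2 * f (a + x)) + 2 * a * (∫ x, x * f (a + x)) + a ^ 2 := by
    rw [← integral_add_left_eq_self (fun x => x ^ 2 * f x) a]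
    have e := (integral_quadratic_mul h0 h1 h2 (2 * a) (a ^ 2)).2
    rw [i0, mul_one] at e
    rw [← e]
    congr 1 with x
    ring
  rw [e1, e2]
  ring

lemma variance_density_pos {f : ℝ → ℝ} (hnn : ∀ x, 0 ≤ f x) (hf : Integrable f)
    (hint : ∫ x, f x = 1) (h1 : Integrable (fun x => x * f x))
    (h2 : Integrable (fun x => x ^ 2 * f x)) :
    0 < (∫ x, x ^ 2 * f x) - (∫ x, x * f x) ^ 2 := by
  set μ := ∫ x, x * f x with hμ
  have e : ∀ x, (x - μ) ^ 2 * f x = (x ^ 2 + -(2 * μ) * x + μ ^ 2) * f x := fun x => by ring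
  obtain ⟨hI, hE⟩ := integral_quadratic_mul hf h1 h2 (-(2 * μ)) (μ ^ 2)
  simp_rw [← e] at hI hE
  replace hE : ∫ x, (x - μ) ^ 2 * f x = (∫ x, x ^ 2 * f x) - μ ^ 2 := by
    rw [hE, hint, ← hμ]
    ring
  have hnn2 : ∀ x, 0 ≤ (x - μ) ^ 2 * f x := fun x => mul_nonneg (sq_nonneg _) (hnn x)
  rw [← hE]
  refine lt_of_le_of_ne (integral_nonneg hnn2) fun h => ?_
  have hz := (integral_eq_zero_iff_of_nonneg hnn2 hI).1 h.symm
  have : ∫ x, f x = 0 := by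
    refine integral_eq_zero_of_ae ?_
    filter_upwards [hz, Measure.ae_ne volume μ] with x hx hxμ
    rcases mul_eq_zero.1 hx with h' | h'
    · exact absurd (sub_eq_zero.1 (pow_eq_zero_iff two_ne_zero |>.1 h')) hxμ
    · simpa using h'
  simp [this] at hint

lemma LogConcaveFun.le_inv_sqrt_variance {f : ℝ → ℝ} (hlc : LogConcaveFun f)
    (hnn : ∀ x, 0 ≤ f x) (hint : ∫ x, f x = 1) (a : ℝ) :
    f a ≤ (Real.sqrt ((∫ x : ℝ, x ^ 2 * f x) - (∫ x : ℝ, x * f x) ^ 2))⁻¹ := by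
  rcases (hnn a).eq_or_lt with ha | ha
  · rw [← ha]; positivity
  have hf : Integrable f := by
    by_contra h
    simp [integral_undef h] at hint
  have hf' : Integrable (fun x => f (a + x)) := hf.comp_add_left a
  have hint' : ∫ x, f (a + x) = 1 := by rw [integral_add_left_eq_self f a, hint]
  obtain ⟨h1, h2, h3⟩ := (hlc.comp_add_left a).sq_mul_variance_le_of_zero (fun x => hnn _) hf' hint'
    (by simpa using ha)
  have hpos := variance_density_pos (fun x => hnn (a + x)) hf' hint' h1 h2
  rw [variance_density_comp_add_left hf hint a h1 h2]
  simp only [add_zero] at h3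
  rw [← one_div, le_div_iff₀ (Real.sqrt_pos.2 hpos)]
  refine abs_le_of_sq_le_sq' ?_ zero_le_one |>.2
  rw [mul_pow, Real.sq_sqrt hpos.le]
  simpa using h3

/-- **Lemma (Bobkov–Chistyakov, Fradelizi).**
For a log-concave probability density `f` on `ℝ`,
`‖f‖_∞ ≤ (∫ x² f(x) dx - (∫ x f(x) dx)²)^{-1/2}`. -/
theorem essSup_le_inv_sqrt_variance_of_logConcave (f : ℝ → ℝ)
    (hmeas : Measurable f) (hnonneg : ∀ x, 0 ≤ f x) (hlc : LogConcaveFun f)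
    (hint : ∫ x : ℝ, f x = 1) :
    essSup f volume ≤ (Real.sqrt ((∫ x : ℝ, x ^ 2 * f x) - (∫ x : ℝ, x * f x) ^ 2))⁻¹ := by
  refine Filter.limsup_le_of_le ?_
    (Filter.Eventually.of_forall (hlc.le_inv_sqrt_variance hnonneg hint))
  exact Filter.isCoboundedUnder_le_of_le _ hnonneg
end

section
/- Define Ψ(x) = (√2/π) ∫_0^∞ (1 + x t²)^{−1/(2x)} dt for 0 < x < 1. Let n ≥ 1 and let a be a unit vector in ℝ^{n+1} with Σ_j a_j = 0 and all coordinates a_j nonzero. Then p_a(0) ≤ (1/√2) · ∏_{j=1}^{n+1} Ψ(a_j²)^{a_j²}. -/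
open MeasureTheory ProbabilityTheory Real

/-- `Ψ(x) = (√2/π) ∫₀^∞ (1 + x t²)^{-1/(2x)} dt`. -/
noncomputable def Psi (x : ℝ) : ℝ :=
  (Real.sqrt 2 / Real.pi) * ∫ t in Set.Ioi (0 : ℝ), (1 + x * t ^ 2) ^ (-(1 / (2 * x)))

lemma charFun_expMeasure_one (t : ℝ) :
    charFun (expMeasure 1) t = (1 - t * Complex.I)⁻¹ := by
  have hd : expMeasure 1 = volume.withDensity (exponentialPDF 1) := rfl
  rw [charFun_apply_real, hd, integral_withDensity_eq_integral_toReal_smul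
    (f := exponentialPDF 1) (measurable_exponentialPDFReal 1).ennreal_ofReal
    (ae_of_all _ fun x => ENNReal.ofReal_lt_top)]
  have hind : (fun x : ℝ => (exponentialPDF 1 x).toReal • Complex.exp (t * x * Complex.I))
      = (Set.Ici (0 : ℝ)).indicator
        (fun x : ℝ => Complex.exp ((t * Complex.I - 1) * x)) := by
    ext x
    by_cases hx : 0 ≤ x
    · rw [Set.indicator_of_mem (Set.mem_Ici.2 hx), exponentialPDF_of_nonneg hx,
        ENNReal.toReal_ofReal (by positivity), one_mul, one_mul, Complex.real_smul,
        Complex.ofReal_exp, ← Complex.exp_add]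
      congr 1
      push_cast
      ring
    · rw [Set.indicator_of_notMem (by simpa using hx), exponentialPDF_of_neg (not_le.1 hx)]
      simp
  rw [hind, integral_indicator measurableSet_Ici, integral_Ici_eq_integral_Ioi,
    integral_exp_mul_complex_Ioi (by simp), Complex.ofReal_zero, mul_zero, Complex.exp_zero,
    neg_div, one_div, ← inv_neg, neg_sub]

lemma norm_charFun_expMeasure_one (t : ℝ) :
    ‖charFun (expMeasure 1) t‖ = (1 + t ^ 2) ^ (-(1 / 2) : ℝ) := by
  rw [charFun_expMeasure_one, norm_inv, Complex.norm_def, Real.rpow_neg (by positivity),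
    ← Real.sqrt_eq_rpow]
  congr 2
  simp [Complex.normSq_apply]
  ring

lemma charFun_map_sum_mul_pi {ι : Type*} [Fintype ι] (μ : Measure ℝ) [SigmaFinite μ]
    (a : ι → ℝ) (t : ℝ) :
    charFun (Measure.map (fun x : ι → ℝ => ∑ j, a j * x j) (Measure.pi fun _ => μ)) t
      = ∏ j, charFun μ (a j * t) := by
  rw [charFun_apply_real, integral_map (Measurable.aemeasurable (by fun_prop)) (by fun_prop)]
  simp_rw [charFun_apply_real]
  rw [← integral_fintype_prod_eq_prod (fun j (x : ℝ) =>
    Complex.exp (((a j * t : ℝ) : ℂ) * x * Complex.I))]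
  congr 1 with x
  rw [← Complex.exp_sum]
  congr 1
  push_cast
  rw [Finset.mul_sum, Finset.sum_mul]
  exact Finset.sum_congr rfl fun j _ => by ring

lemma fourier_ofReal_max_eq_charFun {p : ℝ → ℝ} (hp : Measurable p) (w : ℝ) :
    FourierTransform.fourier (fun x => ((max (p x) 0 : ℝ) : ℂ)) w
      = charFun (volume.withDensity fun x => ENNReal.ofReal (p x)) (-(2 * π * w)) := by
  rw [charFun_apply_real, integral_withDensity_eq_integral_toReal_smul hp.ennreal_ofReal
    (ae_of_all _ fun x => ENNReal.ofReal_lt_top), fourier_real_eq_integral_exp_smul]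
  congr 1 with x
  rw [ENNReal.toReal_ofReal', smul_eq_mul, Complex.real_smul, mul_comm]
  congr 3
  push_cast
  ring

/-- The value at `0` of a continuous probability density is at most `(2π)⁻¹` times the `L¹` norm
of its characteristic function. -/
lemma density_zero_le_integral_norm_charFun {p : ℝ → ℝ} (hp : Continuous p)
    [IsFiniteMeasure (volume.withDensity fun x => ENNReal.ofReal (p x))]
    (hint : Integrable (charFun (volume.withDensity fun x => ENNReal.ofReal (p x)))) :
    p 0 ≤ (2 * π)⁻¹ *
      ∫ t, ‖charFun (volume.withDensity fun x => ENNReal.ofReal (p x)) t‖ := by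
  set φ := charFun (volume.withDensity fun x => ENNReal.ofReal (p x)) with hφ
  have hf : FourierTransform.fourier (fun x => ((max (p x) 0 : ℝ) : ℂ))
      = fun w => φ (-(2 * π) * w) := by
    ext w
    rw [fourier_ofReal_max_eq_charFun hp.measurable, ← hφ, neg_mul]
  have hne : -(2 * π) ≠ 0 := by have := pi_pos; linarith
  have hpint : Integrable (fun x => max (p x) 0) := by
    refine ⟨by fun_prop, ?_⟩
    rw [hasFiniteIntegral_iff_ofReal (ae_of_all _ fun x => le_max_right (p x) 0)]
    have := measure_lt_top (volume.withDensity fun x => ENNReal.ofReal (p x)) Set.univ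
    rw [withDensity_apply _ MeasurableSet.univ, Measure.restrict_univ] at this
    simpa [ENNReal.ofReal_max] using this
  have hinv := hpint.ofReal (𝕜 := ℂ) |>.fourierInv_fourier_eq
    (by rw [show (fun x => (RCLike.ofReal (max (p x) 0) : ℂ))
          = fun x => ((max (p x) 0 : ℝ) : ℂ) from rfl, hf]
        exact hint.comp_mul_left' hne)
    (v := 0) (by
      have : Continuous fun x => ((max (p x) 0 : ℝ) : ℂ) := by fun_prop
      exact this.continuousAt)
  calc p 0 ≤ ‖((max (p 0) 0 : ℝ) : ℂ)‖ := by
        rw [Complex.norm_real, Real.norm_eq_abs]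
        exact (le_max_left _ _).trans (le_abs_self _)
    _ = ‖∫ w, φ (-(2 * π) * w)‖ := by
        rw [show ((max (p 0) 0 : ℝ) : ℂ) = _ from hinv.symm, Real.fourierInv_eq']
        rw [show (fun x => (RCLike.ofReal (max (p x) 0) : ℂ))
          = fun x => ((max (p x) 0 : ℝ) : ℂ) from rfl, hf]
        simp
    _ ≤ ∫ w, ‖φ (-(2 * π) * w)‖ := norm_integral_le_integral_norm _
    _ = (2 * π)⁻¹ * ∫ t, ‖φ t‖ := by
        rw [Measure.integral_comp_mul_left (fun t => ‖φ t‖), abs_inv, abs_neg,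
          abs_of_pos (by positivity), smul_eq_mul]

/-- Hölder's inequality for finitely many nonnegative integrable functions. -/
lemma integral_prod_rpow_le {ι α : Type*} [Fintype ι] [MeasurableSpace α] {μ : Measure α}
    {G : ι → α → ℝ} (hG : ∀ i, Integrable (G i) μ) (h0 : ∀ i x, 0 ≤ G i x)
    {w : ι → ℝ} (hw : ∑ i, w i = 1) (hw0 : ∀ i, 0 ≤ w i) :
    Integrable (fun x => ∏ i, G i x ^ w i) μ ∧
      ∫ x, ∏ i, G i x ^ w i ∂μ ≤ ∏ i, (∫ x, G i x ∂μ) ^ w i := by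
  have hmeas : AEStronglyMeasurable (fun x => ∏ i, G i x ^ w i) μ :=
    (Finset.aemeasurable_fun_prod _ fun i _ =>
      (hG i).aemeasurable.pow_const (w i)).aestronglyMeasurable
  have hnn : ∀ x, 0 ≤ ∏ i, G i x ^ w i := fun x =>
    Finset.prod_nonneg fun i _ => rpow_nonneg (h0 i x) _
  have hlint : ∫⁻ x, ENNReal.ofReal (∏ i, G i x ^ w i) ∂μ
      ≤ ENNReal.ofReal (∏ i, (∫ x, G i x ∂μ) ^ w i) := by
    have h := ENNReal.lintegral_prod_norm_pow_le Finset.univ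
      (f := fun i x => ENNReal.ofReal (G i x)) (μ := μ)
      (fun i _ => (hG i).aemeasurable.ennreal_ofReal) hw (fun i _ => hw0 i)
    convert h using 1
    · refine lintegral_congr fun x => ?_
      rw [ENNReal.ofReal_prod_of_nonneg fun i _ => rpow_nonneg (h0 i x) _]
      exact Finset.prod_congr rfl fun i _ =>
        (ENNReal.ofReal_rpow_of_nonneg (h0 i x) (hw0 i)).symm
    · rw [ENNReal.ofReal_prod_of_nonneg fun i _ => rpow_nonneg (integral_nonneg (h0 i)) _]
      refine Finset.prod_congr rfl fun i _ => ?_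
      rw [← ENNReal.ofReal_rpow_of_nonneg (integral_nonneg (h0 i)) (hw0 i),
        ofReal_integral_eq_lintegral_ofReal (hG i) (ae_of_all _ (h0 i))]
  refine ⟨⟨hmeas, ?_⟩, ?_⟩
  · rw [hasFiniteIntegral_iff_ofReal (ae_of_all _ hnn)]
    exact hlint.trans_lt ENNReal.ofReal_lt_top
  · rw [integral_eq_lintegral_of_nonneg_ae (ae_of_all _ hnn) hmeas]
    exact ENNReal.toReal_le_of_le_ofReal
      (Finset.prod_nonneg fun i _ => rpow_nonneg (integral_nonneg (h0 i)) _) hlint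

lemma integrable_one_add_mul_sq_rpow {x : ℝ} (hx0 : 0 < x) (hx1 : x < 1) :
    Integrable fun t : ℝ => (1 + x * t ^ 2) ^ (-(1 / (2 * x))) := by
  have h := (integrable_rpow_neg_one_add_norm_sq (E := ℝ) (μ := volume) (r := 1 / x)
    (by simpa using (one_lt_inv₀ hx0).2 hx1)).comp_mul_left' (Real.sqrt_pos.2 hx0).ne'
  refine h.congr (ae_of_all _ fun t => ?_)
  simp only [norm_eq_abs, sq_abs, mul_pow, Real.sq_sqrt hx0.le]
  congr 1
  field_simp

lemma integral_one_add_mul_sq_rpow (x : ℝ) :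
    ∫ t : ℝ, (1 + x * t ^ 2) ^ (-(1 / (2 * x))) = √2 * π * Psi x := by
  have h := integral_comp_abs (f := fun t : ℝ => (1 + x * t ^ 2) ^ (-(1 / (2 * x))))
  simp only [sq_abs] at h
  rw [h, Psi, ← mul_assoc]
  congr 1
  have := pi_pos
  field_simp
  norm_num

lemma sq_lt_one_of_sum_eq_zero {ι : Type*} [Fintype ι] {a : ι → ℝ}
    (hsq : ∑ j, a j ^ 2 = 1) (hsum : ∑ j, a j = 0) (i : ι) : a i ^ 2 < 1 := by
  classical
  have hsq' := Finset.add_sum_erase Finset.univ (fun j => a j ^ 2) (Finset.mem_univ i)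
  have hsum' := Finset.add_sum_erase Finset.univ a (Finset.mem_univ i)
  by_contra! h
  have hle : ∑ j ∈ Finset.univ.erase i, a j ^ 2 ≤ 0 := by
    linarith
  have hz : ∀ j ∈ Finset.univ.erase i, a j ^ 2 = 0 :=
    (Finset.sum_eq_zero_iff_of_nonneg fun j _ => sq_nonneg (a j)).1
      (le_antisymm hle (Finset.sum_nonneg fun j _ => sq_nonneg (a j)))
  rw [Finset.sum_eq_zero fun j hj => pow_eq_zero_iff two_ne_zero |>.1 (hz j hj)] at hsum'
  have : a i = 0 := by linarith
  rw [this] at h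
  norm_num at h

/-- **Fourier-analytic bound on central sections of the simplex.**
For a unit vector `a ∈ ℝ^{n+1}` with `∑ aⱼ = 0` and all `aⱼ ≠ 0`,
`p_a(0) ≤ (1/√2) ∏ⱼ Ψ(aⱼ²)^{aⱼ²}`. -/
theorem fourier_bound_simplex_sections (n : ℕ) (hn : 1 ≤ n)
    (a : EuclideanSpace ℝ (Fin (n + 1))) (hnorm : ‖a‖ = 1)
    (hsum : ∑ j, a j = 0) (hne : ∀ j, a j ≠ 0)
    (p : ℝ → ℝ) (hp : IsExpSumDensity (fun j => a j) p) :
    p 0 ≤ (Real.sqrt 2)⁻¹ * ∏ j, Psi (a j ^ 2) ^ (a j ^ 2) := by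
  obtain ⟨hcont, hmap⟩ := hp
  have hsq : ∑ j, a j ^ 2 = 1 := by
    rw [← EuclideanSpace.real_norm_sq_eq, hnorm, one_pow]
  have hpos : ∀ j, 0 < a j ^ 2 := fun j => by have := hne j; positivity
  have hlt : ∀ j, a j ^ 2 < 1 := sq_lt_one_of_sum_eq_zero hsq hsum
  have : IsProbabilityMeasure (expMeasure 1) := isProbabilityMeasure_expMeasure one_pos
  set ν := volume.withDensity fun x => ENNReal.ofReal (p x) with hν
  have : IsProbabilityMeasure ν := by
    rw [← hmap]
    exact Measure.isProbabilityMeasure_map (Measurable.aemeasurable (by fun_prop))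
  have hφ : ∀ t, ‖charFun ν t‖
      = ∏ j, ((1 + a j ^ 2 * t ^ 2) ^ (-(1 / (2 * a j ^ 2)))) ^ (a j ^ 2) := fun t => by
    rw [← hmap, charFun_map_sum_mul_pi, norm_prod]
    refine Finset.prod_congr rfl fun j _ => ?_
    rw [norm_charFun_expMeasure_one, ← Real.rpow_mul (by positivity), mul_pow]
    have := hne j
    congr 1
    field_simp
  obtain ⟨hint, hle⟩ := integral_prod_rpow_le
    (fun j => integrable_one_add_mul_sq_rpow (hpos j) (hlt j))
    (fun j t => by positivity) hsq fun j => (hpos j).le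
  have hΨ : ∀ j, 0 ≤ Psi (a j ^ 2) := fun j =>
    mul_nonneg (by positivity) (integral_nonneg fun t => by positivity)
  have hprod : ∏ j, (√2 * π * Psi (a j ^ 2)) ^ (a j ^ 2)
      = √2 * π * ∏ j, Psi (a j ^ 2) ^ (a j ^ 2) := by
    simp_rw [fun j => Real.mul_rpow (z := a j ^ 2) (by positivity : 0 ≤ √2 * π) (hΨ j)]
    rw [Finset.prod_mul_distrib, ← Real.rpow_sum_of_pos (by positivity), hsq, rpow_one]
  have hφint : Integrable (charFun ν) :=
    (integrable_norm_iff measurable_charFun.aestronglyMeasurable).1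
      (hint.congr (ae_of_all _ fun t => (hφ t).symm))
  calc p 0 ≤ (2 * π)⁻¹ * ∫ t, ‖charFun ν t‖ :=
        density_zero_le_integral_norm_charFun hcont hφint
    _ ≤ (2 * π)⁻¹ * (√2 * π * ∏ j, Psi (a j ^ 2) ^ (a j ^ 2)) := by
        simp_rw [hφ, ← hprod, ← integral_one_add_mul_sq_rpow]
        gcongr
    _ = (√2)⁻¹ * ∏ j, Psi (a j ^ 2) ^ (a j ^ 2) := by
        rw [← mul_assoc]
        congr 1
        have := pi_pos
        field_simp
        norm_num
end

section
/- Define Ψ(x) = (√2/π) ∫_0^∞ (1 + x t²)^{−1/(2x)} dt for 0 < x < 1. Then Ψ is strictly increasing on (0,1), Ψ(1/2) = 1, and Ψ(x) = (1/√(2πx)) · Γ(1/(2x) − 1/2) / Γ(1/(2x)) for all 0 < x < 1, where Γ denotes the Gamma function. -/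
open MeasureTheory Real Set

/-- The Gaussian integral in `t` of the Gamma-integral representation of `(1 + x t²)^(-s)`. -/
lemma integral_rpow_mul_exp_neg_one_add_mul_sq_mul {u : ℝ} (x : ℝ) (hu : 0 < u) (s : ℝ) :
    ∫ t in Ioi (0 : ℝ), u ^ (s - 1) * exp (-((1 + x * t ^ 2) * u)) =
      √(π / x) / 2 * (exp (-u) * u ^ (s - 1 / 2 - 1)) := by
  have h (t : ℝ) : u ^ (s - 1) * exp (-((1 + x * t ^ 2) * u)) =
      (u ^ (s - 1) * exp (-u)) * exp (-(x * u) * t ^ 2) := by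
    rw [mul_assoc, ← exp_add]
    ring_nf
  simp_rw [h]
  rw [integral_const_mul, integral_gaussian_Ioi, ← div_div, sqrt_div' _ hu.le, sqrt_eq_rpow u,
    show s - 1 / 2 - 1 = (s - 1) - 1 / 2 by ring, rpow_sub hu (s - 1) (1 / 2)]
  ring

lemma integrable_rpow_mul_exp_neg_one_add_mul_sq_mul {x s : ℝ} (hx : 0 < x) (hs : 1 / 2 < s) :
    Integrable (Function.uncurry fun t u : ℝ ↦ u ^ (s - 1) * exp (-((1 + x * t ^ 2) * u)))
      ((volume.restrict (Ioi 0)).prod (volume.restrict (Ioi 0))) := by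
  rw [integrable_prod_iff' (Measurable.aestronglyMeasurable (by fun_prop))]
  constructor
  · refine (ae_restrict_mem measurableSet_Ioi).mono fun u (hu : 0 < u) ↦ ?_
    refine ((integrable_exp_neg_mul_sq (mul_pos hx hu)).const_mul
      (u ^ (s - 1) * exp (-u))).restrict.congr (.of_forall fun t ↦ ?_)
    simp only [Function.uncurry_apply_pair]
    rw [mul_assoc, ← exp_add]
    ring_nf
  · refine ((GammaIntegral_convergent (sub_pos.2 hs)).const_mul (√(π / x) / 2)).congr ?_
    refine (ae_restrict_mem measurableSet_Ioi).mono fun u (hu : 0 < u) ↦ ?_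
    dsimp only
    rw [← integral_rpow_mul_exp_neg_one_add_mul_sq_mul x hu]
    refine integral_congr_ae (.of_forall fun t ↦ ?_)
    exact (norm_of_nonneg (by dsimp only [Function.uncurry]; positivity)).symm

lemma integral_rpow_mul_exp_neg_one_add_mul_sq_mul_right {x s : ℝ} (hx : 0 < x) (hs : 0 < s)
    (t : ℝ) :
    ∫ u in Ioi (0 : ℝ), u ^ (s - 1) * exp (-((1 + x * t ^ 2) * u)) =
      (1 + x * t ^ 2) ^ (-s) * Real.Gamma s := by
  have h : 0 < 1 + x * t ^ 2 := by positivity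
  rw [integral_rpow_mul_exp_neg_mul_Ioi hs h, one_div, inv_rpow h.le, rpow_neg h.le]

lemma integrableOn_one_add_mul_sq_rpow_neg {x s : ℝ} (hx : 0 < x) (hs : 1 / 2 < s) :
    IntegrableOn (fun t : ℝ ↦ (1 + x * t ^ 2) ^ (-s)) (Ioi 0) := by
  have hs0 : 0 < s := by linarith
  have h := (integrable_rpow_mul_exp_neg_one_add_mul_sq_mul hx hs).integral_prod_left
  simp only [Function.uncurry_apply_pair,
    integral_rpow_mul_exp_neg_one_add_mul_sq_mul_right hx hs0] at h
  exact (integrable_mul_const_iff (Gamma_pos_of_pos hs0).ne'.isUnit _).1 h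

lemma integral_one_add_mul_sq_rpow_neg {x s : ℝ} (hx : 0 < x) (hs : 1 / 2 < s) :
    ∫ t in Ioi (0 : ℝ), (1 + x * t ^ 2) ^ (-s) =
      √(π / x) / 2 * (Real.Gamma (s - 1 / 2) / Real.Gamma s) := by
  have hs0 : 0 < s := by linarith
  have h := integral_integral_swap (integrable_rpow_mul_exp_neg_one_add_mul_sq_mul hx hs)
  simp only [integral_rpow_mul_exp_neg_one_add_mul_sq_mul_right hx hs0] at h
  rw [integral_mul_const, setIntegral_congr_fun measurableSet_Ioi fun u hu ↦
    integral_rpow_mul_exp_neg_one_add_mul_sq_mul x hu s, integral_const_mul,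
    ← Gamma_eq_integral (sub_pos.2 hs)] at h
  rw [← mul_div_assoc, eq_div_iff (Gamma_pos_of_pos hs0).ne', h]

lemma one_add_mul_sq_rpow_lt {x y t : ℝ} (hx : 0 < x) (hxy : x < y) (ht : 0 < t) :
    (1 + x * t ^ 2) ^ (-(1 / (2 * x))) < (1 + y * t ^ 2) ^ (-(1 / (2 * y))) := by
  have hy : 0 < y := hx.trans hxy
  have hyt : 0 < y * t ^ 2 := by positivity
  have h := rpow_one_add_lt_one_add_mul_self (s := y * t ^ 2) (by linarith) hyt.ne'
    (div_pos hx hy) ((div_lt_one hy).2 hxy)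
  rw [show x / y * (y * t ^ 2) = x * t ^ 2 by field_simp] at h
  have h' := rpow_lt_rpow_of_neg (by positivity) h
    (show -(1 / (2 * x)) < 0 by rw [neg_lt_zero]; positivity)
  rwa [← rpow_mul (by positivity), show x / y * -(1 / (2 * x)) = -(1 / (2 * y)) by field_simp]
    at h'

lemma half_lt_one_div_two_mul {x : ℝ} (hx : x ∈ Ioo (0 : ℝ) 1) : 1 / 2 < 1 / (2 * x) :=
  one_div_lt_one_div_of_lt (by linarith [hx.1]) (by linarith [hx.2])

lemma strictMonoOn_Psi : StrictMonoOn Psi (Ioo (0 : ℝ) 1) := by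
  intro x hx y hy hxy
  have hix := integrableOn_one_add_mul_sq_rpow_neg hx.1 (half_lt_one_div_two_mul hx)
  have hiy := integrableOn_one_add_mul_sq_rpow_neg hy.1 (half_lt_one_div_two_mul hy)
  refine mul_lt_mul_of_pos_left ?_ (by positivity)
  rw [← sub_pos, ← integral_sub hiy hix]
  have hpos (t : ℝ) (ht : t ∈ Ioi (0 : ℝ)) :
      0 < (1 + y * t ^ 2) ^ (-(1 / (2 * y))) - (1 + x * t ^ 2) ^ (-(1 / (2 * x))) :=
    sub_pos.2 (one_add_mul_sq_rpow_lt hx.1 hxy ht)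
  rw [setIntegral_pos_iff_support_of_nonneg_ae
    ((ae_restrict_mem measurableSet_Ioi).mono fun t ht ↦ (hpos t ht).le) (hiy.sub hix)]
  rw [inter_eq_right.2 fun t ht ↦ Function.mem_support.2 (hpos t ht).ne', Real.volume_Ioi]
  exact ENNReal.zero_lt_top

lemma Psi_eq_Gamma_div_Gamma {x : ℝ} (hx : x ∈ Ioo (0 : ℝ) 1) :
    Psi x = (√(2 * π * x))⁻¹ *
      (Real.Gamma (1 / (2 * x) - 1 / 2) / Real.Gamma (1 / (2 * x))) := by
  have hx0 := hx.1
  rw [Psi, integral_one_add_mul_sq_rpow_neg hx0 (half_lt_one_div_two_mul hx), ← mul_assoc]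
  congr 1
  rw [sqrt_div pi_pos.le, sqrt_mul (by positivity), sqrt_mul zero_le_two]
  field_simp
  rw [sq_sqrt zero_le_two, sq_sqrt pi_pos.le]
  ring

/-- **Properties of `Ψ`.** The function `Ψ` is strictly increasing on `(0,1)`, `Ψ(1/2) = 1`,
and `Ψ(x) = (1/√(2πx)) ⬝ Γ(1/(2x) - 1/2) / Γ(1/(2x))`. -/
theorem Psi_strictMono_and_value_and_gamma_formula :
    StrictMonoOn Psi (Set.Ioo (0 : ℝ) 1) ∧
      Psi (1 / 2) = 1 ∧
      ∀ x ∈ Set.Ioo (0 : ℝ) 1,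
        Psi x = (Real.sqrt (2 * Real.pi * x))⁻¹ *
          (Real.Gamma (1 / (2 * x) - 1 / 2) / Real.Gamma (1 / (2 * x))) := by
  refine ⟨strictMonoOn_Psi, ?_, fun x hx ↦ Psi_eq_Gamma_div_Gamma hx⟩
  rw [Psi_eq_Gamma_div_Gamma (by norm_num)]
  have hpi : √π ≠ 0 := (sqrt_pos.2 pi_pos).ne'
  rw [show (2 : ℝ) * π * (1 / 2) = π by ring, show (1 : ℝ) / (2 * (1 / 2)) = 1 by norm_num,
    show (1 : ℝ) - 1 / 2 = 1 / 2 by norm_num, Gamma_one_half_eq, Gamma_one, div_one,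
    inv_mul_cancel₀ hpi]
end
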